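/- arXiv:2509.06207 — 6 statements merged into one kernel-verified Lean document; each statement's English description precedes it below -/
import Mathlib

section
/- If a finite group G acts transitively on a finite set X and ℱ is a (G, j)-balanced family of k-subsets of X, then ℱ is an EKR family. -/
/-- A family of finite sets is *intersecting* if any two of its members share an element. -/
def IsIntersectingFamily {α : Type*} (ℬ : Set (Finset α)) : Prop :=
  ∀ A ∈ ℬ, ∀ B ∈ ℬ, ∃ x, x ∈ A ∧ x ∈ B

/-- The subfamily of all members of `𝒜` that contain `x`. -/
def famAt {α : Type*} (𝒜 : Set (Finset α)) (x : α) : Set (Finset α) :=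
  {A ∈ 𝒜 | x ∈ A}

/-- `𝒜` is an *EKR family* over the ground set `X`: for every `x ∈ X`, the subfamily
`famAt 𝒜 x` has maximum cardinality among all intersecting subfamilies of `𝒜`. -/
def IsEKRFamily {α : Type*} (X : Set α) (𝒜 : Set (Finset α)) : Prop :=
  ∀ x ∈ X, ∀ ℬ ⊆ 𝒜, IsIntersectingFamily ℬ → ℬ.ncard ≤ (famAt 𝒜 x).ncard

/-- `𝒜` is a *strong EKR family* over the ground set `X`: it is an EKR family and moreover
every intersecting subfamily of maximum cardinality equals `famAt 𝒜 x` for some `x ∈ X`. -/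
def IsStrongEKRFamily {α : Type*} (X : Set α) (𝒜 : Set (Finset α)) : Prop :=
  IsEKRFamily X 𝒜 ∧ ∀ ℬ ⊆ 𝒜, IsIntersectingFamily ℬ →
    (∀ 𝒞 ⊆ 𝒜, IsIntersectingFamily 𝒞 → 𝒞.ncard ≤ ℬ.ncard) → ∃ x ∈ X, ℬ = famAt 𝒜 x

open scoped Pointwise in
theorem gb_fiber {α : Type*} [DecidableEq α] (G : Type*) [Group G] [Fintype G] [MulAction G α]
    (F₀ F F' : Finset α) (a b : G) (ha : a • F₀ = F) (hb : b • F₀ = F') :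
    (Finset.univ.filter fun g : G => g • F = F').card
      = (Finset.univ.filter fun g : G => g • F₀ = F₀).card := by
  subst ha hb
  refine Finset.card_bij' (fun g _ => b⁻¹ * g * a) (fun g _ => b * g * a⁻¹) ?_ ?_ ?_ ?_
  · intro g hg
    simp only [Finset.mem_filter, Finset.mem_univ, true_and] at hg ⊢
    rw [mul_smul, mul_smul, hg, inv_smul_smul]
  · intro g hg
    simp only [Finset.mem_filter, Finset.mem_univ, true_and] at hg ⊢
    rw [mul_smul, mul_smul, inv_smul_smul, hg]
  · intro g _
    group
  · intro g _
    group

open scoped Pointwise in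
theorem gb_count {α : Type*} [DecidableEq α] (G : Type*) [Group G] [Fintype G] [MulAction G α]
    (ℱ : Set (Finset α)) (htransF : ∀ F ∈ ℱ, ∀ F' ∈ ℱ, ∃ g : G, g • F = F')
    (R : ℕ) (D : Fin R → Finset α) (hD : ∀ t, D t ∈ ℱ) (F₀ : Finset α) (h0 : F₀ ∈ ℱ)
    (B : Finset (Finset α)) (hB : ∀ F ∈ B, F ∈ ℱ) :
    ∑ g : G, (Finset.univ.filter fun t : Fin R => g • D t ∈ B).card
      = R * (B.card * (Finset.univ.filter fun g : G => g • F₀ = F₀).card) := by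
  have h1 : ∑ g : G, (Finset.univ.filter fun t : Fin R => g • D t ∈ B).card
      = ∑ t : Fin R, (Finset.univ.filter fun g : G => g • D t ∈ B).card :=
    Finset.sum_card_bipartiteAbove_eq_sum_card_bipartiteBelow
      (s := Finset.univ) (t := Finset.univ) (fun (g : G) (t : Fin R) => g • D t ∈ B)
  rw [h1]
  have h2 : ∀ t : Fin R, (Finset.univ.filter fun g : G => g • D t ∈ B).card
      = B.card * (Finset.univ.filter fun g : G => g • F₀ = F₀).card := by
    intro t
    rw [Finset.card_eq_sum_card_fiberwise (f := fun g : G => g • D t) (t := B)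
      (fun g hg => by simpa using hg)]
    rw [← smul_eq_mul, ← Finset.sum_const]
    refine Finset.sum_congr rfl fun F' hF' => ?_
    obtain ⟨a, ha⟩ := htransF F₀ h0 (D t) (hD t)
    obtain ⟨b, hb⟩ := htransF F₀ h0 F' (hB F' hF')
    rw [← gb_fiber G F₀ (D t) F' a b ha hb, Finset.filter_filter]
    congr 1
    ext g
    simp only [Finset.mem_filter, Finset.mem_univ, true_and]
    exact ⟨fun h => h.2, fun h => ⟨h ▸ hF', h⟩⟩
  simp [h2]

/-- **G-balanced Lemma.** If a finite group `G` acts transitively on a finite set `α` and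
`ℱ` is a `(G, j)`-balanced family of `k`-subsets of `α`, then `ℱ` is an EKR family. -/
theorem gBalanced_isEKR {α : Type*} [Fintype α] [DecidableEq α]
    (G : Type*) [Group G] [Finite G] [MulAction G α]
    -- `G` acts transitively on the ground set
    (htransX : ∀ x y : α, ∃ g : G, g • x = y)
    (k j : ℕ) (hj : 0 < j)
    (ℱ : Set (Finset α)) (hk : ∀ F ∈ ℱ, F.card = k)
    -- (i) `G` acts (transitively) on `ℱ` via the extended action `gA = {ga : a ∈ A}`
    (hclosed : ∀ F ∈ ℱ, ∀ g : G, F.image (g • ·) ∈ ℱ)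
    (htransF : ∀ F ∈ ℱ, ∀ F' ∈ ℱ, ∃ g : G, F.image (g • ·) = F')
    -- (ii) there are `D 1, …, D r ∈ ℱ` covering every element of `α` exactly `j` times
    (R : ℕ) (D : Fin R → Finset α) (hD : ∀ t, D t ∈ ℱ)
    (hcover : ∀ x : α, (Finset.univ.filter fun t : Fin R => x ∈ D t).card = j)
    -- (iii) no more than `j` of the sets `D t` form an intersecting family
    (hmax : ∀ S : Finset (Fin R),
      (∀ t ∈ S, ∀ t' ∈ S, ∃ x, x ∈ D t ∧ x ∈ D t') → S.card ≤ j) :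
    IsEKRFamily Set.univ ℱ := by
  classical
  have := Fintype.ofFinite G
  letI : MulAction G (Finset α) := Finset.mulActionFinset
  have hsm : ∀ (g : G) (F : Finset α), g • F = F.image (g • ·) := fun _ _ => rfl
  intro x _ ℬ hℬ hint
  have hne : (Finset.univ.filter fun t : Fin R => x ∈ D t).Nonempty := by
    rw [← Finset.card_pos, hcover x]; exact hj
  obtain ⟨t₀, _⟩ := hne
  have hR : 0 < R := Fin.pos t₀
  have key := gb_count G ℱ htransF R D hD (D t₀) (hD t₀)
  rw [Set.ncard_eq_toFinset_card' ℬ, Set.ncard_eq_toFinset_card' (famAt ℱ x)]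
  have k1 := key ℬ.toFinset (fun F hF => hℬ (by simpa using hF))
  have k2 := key (famAt ℱ x).toFinset (fun F hF => by
    rw [Set.mem_toFinset] at hF; exact hF.1)
  have hpos : 0 < (Finset.univ.filter fun g : G => g • D t₀ = D t₀).card :=
    Finset.card_pos.2 ⟨1, by simp⟩
  have hle : ∀ g : G, (Finset.univ.filter fun t : Fin R => g • D t ∈ ℬ.toFinset).card
      ≤ (Finset.univ.filter fun t : Fin R => g • D t ∈ (famAt ℱ x).toFinset).card := by
    intro g
    have e : (Finset.univ.filter fun t : Fin R => g • D t ∈ (famAt ℱ x).toFinset)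
        = Finset.univ.filter fun t : Fin R => g⁻¹ • x ∈ D t := by
      ext t
      simp only [Finset.mem_filter, Finset.mem_univ, true_and, Set.mem_toFinset]
      constructor
      · rintro ⟨_, h⟩
        rw [hsm, Finset.mem_image] at h
        obtain ⟨y, hy, rfl⟩ := h
        simpa using hy
      · intro h
        exact ⟨hclosed _ (hD t) g, Finset.mem_image.2 ⟨_, h, by simp⟩⟩
    rw [e, hcover]
    apply hmax
    intro t ht t' ht'
    simp only [Finset.mem_filter, Finset.mem_univ, true_and, Set.mem_toFinset] at ht ht'
    obtain ⟨y, hy, hy'⟩ := hint _ ht _ ht'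
    rw [hsm, Finset.mem_image] at hy hy'
    obtain ⟨z, hz, rfl⟩ := hy
    obtain ⟨w, hw, hwz⟩ := hy'
    have : w = z := MulAction.injective g hwz
    exact ⟨z, hz, this ▸ hw⟩
  have hs := Finset.sum_le_sum fun g (_ : g ∈ (Finset.univ : Finset G)) => hle g
  have hs2 := (k1.symm.le.trans hs).trans k2.le
  exact Nat.le_of_mul_le_mul_right (Nat.le_of_mul_le_mul_left hs2 hR) hpos
end

section
/- For every integer n ≥ 5, the family ℱ_n(C_n) of all Hamiltonian cycles of the complete graph K_n, each identified with its edge set, is an EKR family. -/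
/-- The family of all cycles of length `k` in the complete graph `K_n`, each cycle being
identified with its edge set. -/
def cycleFamily (n k : ℕ) : Set (Finset (Sym2 (Fin n))) :=
  {E | ∃ (v : Fin n) (w : (⊤ : SimpleGraph (Fin n)).Walk v v),
      w.IsCycle ∧ w.length = k ∧ E = w.edges.toFinset}

/-- Vertex sum on `Option (ZMod N)`, with `none` playing the role of the point at infinity. -/
def zsum {N : ℕ} (x y : Option (ZMod N)) : ZMod N := x.getD (y.getD 0) + y.getD (x.getD 0)

lemma zsum_comm {N : ℕ} (x y : Option (ZMod N)) : zsum x y = zsum y x := by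
  simp [zsum, add_comm]

/-- The zigzag sequence. -/
def zig (N : ℕ) (k : ℕ) : Option (ZMod N) :=
  if k = 0 then none else if k % 2 = 0 then some ((k / 2 : ℕ) : ZMod N)
    else some (-((k / 2 : ℕ) : ZMod N))

lemma zig_zero (N : ℕ) : zig N 0 = none := by simp [zig]

lemma zig_odd (N j : ℕ) : zig N (2 * j + 1) = some (-(j : ZMod N)) := by
  have h1 : (2 * j + 1) % 2 ≠ 0 := by omega
  have h2 : (2 * j + 1) / 2 = j := by omega
  simp [zig, h2]

lemma zig_even (N j : ℕ) (hj : 1 ≤ j) : zig N (2 * j) = some (j : ZMod N) := by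
  have h1 : j ≠ 0 := by omega
  simp [zig, h1]

lemma zig_cases (k : ℕ) (hk : 1 ≤ k) : (∃ j, k = 2 * j + 1) ∨ (∃ j, 1 ≤ j ∧ k = 2 * j) := by
  rcases Nat.even_or_odd' k with ⟨j, h | h⟩
  · right; exact ⟨j, by omega, h⟩
  · left; exact ⟨j, h⟩

lemma zig_surj (N : ℕ) (hN : 2 ≤ N) (a : ZMod N) : ∃ k, 1 ≤ k ∧ k ≤ N ∧ zig N k = some a := by
  have : NeZero N := ⟨by omega⟩
  have hv := ZMod.val_lt a
  have ha : ((a.val : ℕ) : ZMod N) = a := ZMod.natCast_zmod_val a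
  by_cases h0 : a.val = 0
  · refine ⟨1, le_rfl, by omega, ?_⟩
    have := zig_odd N 0
    rw [h0] at ha
    simpa [← ha] using this
  by_cases h1 : 2 * a.val ≤ N
  · exact ⟨2 * a.val, by omega, h1, by rw [zig_even _ _ (by omega), ha]⟩
  · refine ⟨2 * (N - a.val) + 1, by omega, by omega, ?_⟩
    rw [zig_odd, Nat.cast_sub hv.le, ha]; simp

lemma two_mul_eq_zero {N j : ℕ} (hj : 1 ≤ j) (hjN : 2 * j < N) : (2 * j : ZMod N) ≠ 0 := by
  intro h
  have h : ((2 * j : ℕ) : ZMod N) = 0 := by push_cast; exact h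
  rw [ZMod.natCast_eq_zero_iff] at h
  have := Nat.le_of_dvd (by omega) h
  omega

lemma two_mul_add_one_eq_zero {N j : ℕ} (hjN : 2 * j + 1 < N) : (2 * j + 1 : ZMod N) ≠ 0 := by
  intro h
  have h : ((2 * j + 1 : ℕ) : ZMod N) = 0 := by push_cast; exact h
  rw [ZMod.natCast_eq_zero_iff] at h
  have := Nat.le_of_dvd (by omega) h
  omega

/-- neighbours in the cyclic order on `0, …, N` -/
def nxt (N k : ℕ) : ℕ := if k = N then 0 else k + 1

lemma zig_fwd (N : ℕ) (k : ℕ) (hk : k ≤ N) :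
    zsum (zig N k) (zig N (nxt N k)) = 0 ∨ zsum (zig N k) (zig N (nxt N k)) = 1 := by
  unfold nxt
  by_cases hkN : k = N
  · subst hkN
    simp only [if_true, zig_zero]
    rcases Nat.eq_zero_or_pos k with rfl | hp
    · simp [zig_zero, zsum]
    rcases zig_cases k hp with ⟨j, h⟩ | ⟨j, hj, h⟩
    · right
      have : ((2 * j + 1 : ℕ) : ZMod k) = 0 := by rw [← h]; simp
      conv_lhs => rw [show zig k k = zig k (2 * j + 1) by rw [← h], zig_odd]
      push_cast at this
      simp only [zsum, Option.getD]
      linear_combination -this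
    · left
      have : ((2 * j : ℕ) : ZMod k) = 0 := by rw [← h]; simp
      conv_lhs => rw [show zig k k = zig k (2 * j) by rw [← h], zig_even _ _ hj]
      push_cast at this
      simp only [zsum, Option.getD]
      linear_combination this
  · rw [if_neg hkN]
    rcases Nat.eq_zero_or_pos k with rfl | hp
    · have := zig_odd N 0
      simp only [Nat.mul_zero, Nat.zero_add] at this
      simp [zig_zero, this, zsum]
    rcases zig_cases k hp with ⟨j, rfl⟩ | ⟨j, hj, rfl⟩
    · right
      rw [zig_odd, show 2 * j + 1 + 1 = 2 * (j + 1) by ring, zig_even _ _ (by omega)]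
      simp [zsum]
    · left
      rw [zig_odd, zig_even _ _ hj]
      simp [zsum]

lemma zig_bwd_none (N : ℕ) (hN : 2 ≤ N) (a : ZMod N) (h : a + a = 0 ∨ a + a = 1) :
    some a = zig N 1 ∨ some a = zig N N := by
  obtain ⟨k, hk1, hkN, hk⟩ := zig_surj N hN a
  rw [← hk]
  rcases zig_cases k hk1 with ⟨j, rfl⟩ | ⟨j, hj, rfl⟩
  · rw [zig_odd] at hk
    have hk := Option.some.inj hk
    rcases Nat.eq_zero_or_pos j with rfl | hj
    · left; rfl
    rcases h with h | h
    · exact absurd (show (2 * j : ZMod N) = 0 by rw [← hk] at h; linear_combination -h)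
        (two_mul_eq_zero hj (by omega))
    · by_cases hlt : 2 * j + 1 < N
      · exact absurd (show (2 * j + 1 : ZMod N) = 0 by rw [← hk] at h; linear_combination -h)
          (two_mul_add_one_eq_zero hlt)
      · right; congr 1; omega
  · rw [zig_even _ _ hj] at hk
    have hk := Option.some.inj hk
    rcases h with h | h
    · by_cases hlt : 2 * j < N
      · exact absurd (show (2 * j : ZMod N) = 0 by rw [← hk] at h; linear_combination h)
          (two_mul_eq_zero hj hlt)
      · right; congr 1; omega
    · obtain ⟨i, rfl⟩ : ∃ i, j = i + 1 := ⟨j - 1, by omega⟩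
      push_cast at hk
      exact absurd (show (2 * i + 1 : ZMod N) = 0 by rw [← hk] at h; linear_combination h)
          (two_mul_add_one_eq_zero (by omega))

lemma zig_bwd_some (N : ℕ) (hN : 2 ≤ N) (a b : ZMod N) (hab : a ≠ b)
    (h : a + b = 0 ∨ a + b = 1) :
    ∃ k, k + 1 ≤ N ∧ ((some a = zig N k ∧ some b = zig N (k + 1)) ∨
      (some b = zig N k ∧ some a = zig N (k + 1))) := by
  obtain ⟨k, hk1, hkN, hk⟩ := zig_surj N hN a
  rcases zig_cases k hk1 with ⟨j, rfl⟩ | ⟨j, hj, rfl⟩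
  · have hk' := hk
    rw [zig_odd] at hk'
    have hk' := Option.some.inj hk'
    rcases h with h | h
    · have hb : b = j := by rw [← hk'] at h; linear_combination h
      rcases Nat.eq_zero_or_pos j with rfl | hj
      · exact absurd (by rw [hb, ← hk']; simp) hab
      · exact ⟨2 * j, hkN, Or.inr ⟨by rw [zig_even _ _ hj, hb], hk.symm⟩⟩
    · have hb : b = j + 1 := by rw [← hk'] at h; linear_combination h
      by_cases hlt : 2 * j + 2 ≤ N
      · refine ⟨2 * j + 1, by omega, Or.inl ⟨hk.symm, ?_⟩⟩
        rw [show 2 * j + 1 + 1 = 2 * (j + 1) by ring, zig_even _ _ (by omega), hb]; simp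
      · have : ((2 * j + 1 : ℕ) : ZMod N) = 0 := by
          rw [show 2 * j + 1 = N by omega]; simp
        push_cast at this
        exact absurd (by rw [hb, ← hk']; linear_combination -this) hab
  · have hk' := hk
    rw [zig_even _ _ hj] at hk'
    have hk' := Option.some.inj hk'
    rcases h with h | h
    · have hb : b = -j := by rw [← hk'] at h; linear_combination h
      by_cases hlt : 2 * j + 1 ≤ N
      · exact ⟨2 * j, hlt, Or.inl ⟨hk.symm, by rw [zig_odd, hb]⟩⟩
      · have : ((2 * j : ℕ) : ZMod N) = 0 := by
          rw [show 2 * j = N by omega]; simp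
        push_cast at this
        exact absurd (by rw [hb, ← hk']; linear_combination this) hab
    · obtain ⟨i, rfl⟩ : ∃ i, j = i + 1 := ⟨j - 1, by omega⟩
      push_cast at hk'
      have hb : b = -i := by rw [← hk'] at h; linear_combination h
      refine ⟨2 * i + 1, by omega, Or.inr ⟨by rw [zig_odd, hb], ?_⟩⟩
      rw [← hk]; rfl

lemma fin_succ_val (N : ℕ) (i : Fin (N + 1)) : (i + 1).val = nxt N i.val := by
  unfold nxt
  rw [Fin.val_add_one]
  simp [Fin.ext_iff]

/-- The base Hamiltonian cycle. -/
lemma exists_base (N : ℕ) (hN : 2 ≤ N) : ∃ z : Fin (N + 1) ≃ Option (ZMod N),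
    ∀ x y, x ≠ y → ((∃ i, s(z i, z (i + 1)) = s(x, y)) ↔ (zsum x y = 0 ∨ zsum x y = 1)) := by
  have : NeZero N := ⟨by omega⟩
  have hsurj : Function.Surjective (fun i : Fin (N + 1) => zig N i.val) := by
    rintro (_ | a)
    · exact ⟨0, by simp [zig_zero]⟩
    · obtain ⟨k, hk1, hkN, hk⟩ := zig_surj N hN a
      exact ⟨⟨k, by omega⟩, hk⟩
  have hbij := (Fintype.bijective_iff_surjective_and_card _).2 ⟨hsurj, by simp [ZMod.card]⟩
  refine ⟨Equiv.ofBijective _ hbij, fun x y hxy => ⟨?_, fun h => ?_⟩⟩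
  · rintro ⟨i, hi⟩
    have := zig_fwd N i.val (by omega)
    simp only [Equiv.ofBijective_apply, fin_succ_val, Sym2.eq_iff] at hi
    rcases hi with ⟨rfl, rfl⟩ | ⟨rfl, rfl⟩
    · exact this
    · rwa [zsum_comm]
  · simp only [Equiv.ofBijective_apply, fin_succ_val]
    have key : ∀ a : ZMod N, (a + a = 0 ∨ a + a = 1) → ∃ i : Fin (N + 1),
        s(zig N i.val, zig N (nxt N i.val)) = s(none, some a) := by
      intro a ha
      rcases zig_bwd_none N hN a ha with h | h
      · refine ⟨0, ?_⟩
        rw [h]; simp [nxt, zig_zero, show 0 ≠ N by omega]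
      · refine ⟨⟨N, by omega⟩, ?_⟩
        rw [h]; simp [nxt, zig_zero]
    rcases x with _ | a <;> rcases y with _ | b
    · exact absurd rfl hxy
    · exact key b (by simpa [zsum] using h)
    · obtain ⟨i, hi⟩ := key a (by simpa [zsum] using h)
      exact ⟨i, by rw [hi, Sym2.eq_swap]⟩
    · obtain ⟨k, hkN, hk⟩ := zig_bwd_some N hN a b (fun h => hxy (by rw [h]))
        (by simpa [zsum] using h)
      refine ⟨⟨k, by omega⟩, ?_⟩
      have : nxt N k = k + 1 := by simp [nxt]; omega
      simp only [this, Sym2.eq_iff]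
      rcases hk with ⟨h1, h2⟩ | ⟨h1, h2⟩
      · left; exact ⟨h1.symm, h2.symm⟩
      · right; exact ⟨h1.symm, h2.symm⟩

/-- All the Hamiltonian cycles `M_s ∪ M_{s+1}`. -/
lemma exists_shift (N : ℕ) (hN : 2 ≤ N) (s : ZMod N) : ∃ z : Fin (N + 1) ≃ Option (ZMod N),
    ∀ x y, x ≠ y →
      ((∃ i, s(z i, z (i + 1)) = s(x, y)) ↔ (zsum x y = s ∨ zsum x y = s + 1)) := by
  have : NeZero N := ⟨by omega⟩
  obtain ⟨z, hz⟩ := exists_base N hN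
  have aux : ∀ φ : ZMod N ≃ ZMod N, (∀ a b, a + b = 0 ∨ a + b = 1 ↔
      φ a + φ b = s ∨ φ a + φ b = s + 1) → ∃ z : Fin (N + 1) ≃ Option (ZMod N),
    ∀ x y, x ≠ y →
      ((∃ i, s(z i, z (i + 1)) = s(x, y)) ↔ (zsum x y = s ∨ zsum x y = s + 1)) := by
    intro φ hφ
    refine ⟨z.trans φ.optionCongr, fun x y hxy => ?_⟩
    obtain ⟨x, rfl⟩ := φ.optionCongr.surjective x
    obtain ⟨y, rfl⟩ := φ.optionCongr.surjective y
    have hxy' : x ≠ y := fun h => hxy (by rw [h])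
    have h1 : (∃ i, s((z.trans φ.optionCongr) i, (z.trans φ.optionCongr) (i + 1)) =
        s(φ.optionCongr x, φ.optionCongr y)) ↔ ∃ i, s(z i, z (i + 1)) = s(x, y) := by
      simp only [Equiv.trans_apply, Sym2.eq_iff, EmbeddingLike.apply_eq_iff_eq]
    rw [h1, hz x y hxy']
    rcases x with _ | a <;> rcases y with _ | b
    · exact absurd rfl hxy'
    all_goals simp [zsum, hφ]
  have hs : (∃ i, s = 2 * i) ∨ ∃ i, s + 1 = 2 * i := by
    rcases Nat.even_or_odd' s.val with ⟨j, h | h⟩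
    · left; refine ⟨j, ?_⟩
      rw [← ZMod.natCast_zmod_val s, h]; push_cast; rfl
    · right; refine ⟨j + 1, ?_⟩
      rw [← ZMod.natCast_zmod_val s, h]; push_cast; ring
  rcases hs with ⟨i, hi⟩ | ⟨i, hi⟩
  · refine aux (Equiv.addLeft i) (fun a b => ?_)
    simp only [Equiv.coe_addLeft]
    constructor <;> rintro (h | h)
    · left; linear_combination h - hi
    · right; linear_combination h - hi
    · left; linear_combination h + hi
    · right; linear_combination h + hi
  · refine aux (Equiv.subLeft i) (fun a b => ?_)
    simp only [Equiv.subLeft_apply]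
    constructor <;> rintro (h | h)
    · right; linear_combination -h - hi
    · left; linear_combination -h - hi
    · right; linear_combination -h - hi
    · left; linear_combination -h - hi

/-- Edge set of the Hamiltonian cycle given by a cyclic ordering of the vertices. -/
def hamEdges {N : ℕ} (f : Equiv.Perm (Fin (N + 1))) : Finset (Sym2 (Fin (N + 1))) :=
  Finset.univ.image fun i => s(f i, f (i + 1))

lemma mem_hamEdges {N : ℕ} (f : Equiv.Perm (Fin (N + 1))) (e : Sym2 (Fin (N + 1))) :
    e ∈ hamEdges f ↔ ∃ i, s(f i, f (i + 1)) = e := by simp [hamEdges]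

lemma mem_hamEdges_mul {N : ℕ} (g f : Equiv.Perm (Fin (N + 1))) (e : Sym2 (Fin (N + 1))) :
    e ∈ hamEdges f ↔ Sym2.map g e ∈ hamEdges (g * f) := by
  simp only [mem_hamEdges]
  refine exists_congr fun i => ?_
  rw [← (Sym2.map.injective g.injective).eq_iff]
  simp

lemma sym2_map_surj {α : Type*} (σ : Equiv.Perm α) (e : Sym2 α) : ∃ e', Sym2.map σ e' = e := by
  induction e using Sym2.ind with | _ x y
  exact ⟨s(σ.symm x, σ.symm y), by simp⟩

lemma hamEdges_mul_congr {N : ℕ} (g f f' : Equiv.Perm (Fin (N + 1)))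
    (h : hamEdges f = hamEdges f') : hamEdges (g * f) = hamEdges (g * f') := by
  ext e
  have := mem_hamEdges_mul g⁻¹ (g * f) e
  have h2 := mem_hamEdges_mul g⁻¹ (g * f') e
  simp only [inv_mul_cancel_left] at this h2
  rw [this, h2, h]

lemma cycle_eq_hamEdges {N : ℕ} {v : Fin (N + 1)} (w : (⊤ : SimpleGraph (Fin (N + 1))).Walk v v)
    (hw : w.IsCycle) (hl : w.length = N + 1) :
    ∃ f : Equiv.Perm (Fin (N + 1)), w.edges.toFinset = hamEdges f := by
  have hinj : Function.Injective (fun i : Fin (N + 1) => w.getVert i.val) := by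
    intro i j hij
    have := hw.getVert_injOn' (x₁ := i.val) (x₂ := j.val)
      (show i.val ≤ w.length - 1 by omega) (show j.val ≤ w.length - 1 by omega) hij
    exact Fin.ext this
  refine ⟨Equiv.ofBijective _ (Finite.injective_iff_bijective.1 hinj), ?_⟩
  ext e
  rw [mem_hamEdges, List.mem_toFinset, List.mem_iff_getElem]
  have hnx : ∀ i : Fin (N + 1), w.getVert (i + 1).val = w.getVert (i.val + 1) := by
    intro i
    rw [fin_succ_val, nxt]
    split_ifs with h
    · rw [w.getVert_of_length_le (i := i.val + 1) (by omega), w.getVert_zero]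
    · rfl
  simp only [Equiv.ofBijective_apply, hnx]
  constructor
  · rintro ⟨k, hk, rfl⟩
    have hk' : k < N + 1 := by simpa [hl] using hk
    refine ⟨⟨k, hk'⟩, ?_⟩
    simp [SimpleGraph.Walk.getElem_edges_eq_edge_getElem_darts, SimpleGraph.Walk.darts_getElem_eq_getVert]
  · rintro ⟨i, rfl⟩
    refine ⟨i.val, by simp [hl]; omega, ?_⟩
    simp [SimpleGraph.Walk.getElem_edges_eq_edge_getElem_darts, SimpleGraph.Walk.darts_getElem_eq_getVert]

lemma hamEdges_mem {N : ℕ} (hN : 2 ≤ N) (f : Equiv.Perm (Fin (N + 1))) :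
    hamEdges f ∈ cycleFamily (N + 1) (N + 1) := by
  obtain ⟨m, rfl⟩ : ∃ m, N = m + 2 := ⟨N - 2, by omega⟩
  let w0 := (SimpleGraph.cycleGraph.cycle m).mapLe (le_top : _ ≤ (⊤ : SimpleGraph (Fin (m + 3))))
  have hw0 : w0.IsCycle := SimpleGraph.cycleGraph.isCycle_cycle.mapLe _
  have hl0 : w0.length = m + 2 + 1 := by
    simp [w0, SimpleGraph.cycleGraph.length_cycle]
  obtain ⟨g, hg⟩ := cycle_eq_hamEdges w0 hw0 hl0
  let σ : Equiv.Perm (Fin (m + 3)) := f * g⁻¹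
  let φ : (⊤ : SimpleGraph (Fin (m + 3))) →g (⊤ : SimpleGraph (Fin (m + 3))) :=
    ⟨σ, by intro a b h; simpa using h⟩
  refine ⟨_, w0.map φ, hw0.map σ.injective, by simp [hl0], ?_⟩
  ext e
  obtain ⟨e, rfl⟩ : ∃ e', Sym2.map σ e' = e := sym2_map_surj σ e
  have h1 := mem_hamEdges_mul σ g e
  rw [show σ * g = f by simp [σ]] at h1
  rw [← h1, ← hg, List.mem_toFinset, List.mem_toFinset,
    SimpleGraph.Walk.edges_map (f := φ) (p := w0)]
  exact (List.mem_map_of_injective (Sym2.map.injective σ.injective)).symm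

lemma cycleFamily_eq {N : ℕ} (hN : 2 ≤ N) :
    cycleFamily (N + 1) (N + 1) = Set.range (hamEdges (N := N)) := by
  ext A
  constructor
  · rintro ⟨v, w, hw, hl, rfl⟩
    obtain ⟨f, hf⟩ := cycle_eq_hamEdges w hw hl
    exact ⟨f, hf.symm⟩
  · rintro ⟨f, rfl⟩
    exact hamEdges_mem hN f

open Classical in
/-- All fibres of `hamEdges` have the same size. -/
lemma card_fibre {N : ℕ} (ℬ : Finset (Finset (Sym2 (Fin (N + 1)))))
    (h : ∀ A ∈ ℬ, ∃ f, hamEdges (N := N) f = A) :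
    (Finset.univ.filter fun f => hamEdges (N := N) f ∈ ℬ).card =
      ℬ.card * (Finset.univ.filter fun f => hamEdges (N := N) f = hamEdges 1).card := by
  rw [Finset.card_eq_sum_card_fiberwise (f := hamEdges (N := N)) (t := ℬ)
    (fun f hf => by simpa using hf), Finset.sum_const_nat]
  intro A hA
  obtain ⟨g, rfl⟩ := h A hA
  refine Finset.card_bij' (fun f _ => g⁻¹ * f) (fun f _ => g * f) ?_ ?_ ?_ ?_
  · intro f hf
    simp only [Finset.mem_filter, Finset.mem_univ, true_and] at hf ⊢
    rw [hamEdges_mul_congr g⁻¹ f g hf.2]; simp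
  · intro f hf
    simp only [Finset.mem_filter, Finset.mem_univ, true_and] at hf ⊢
    have := hamEdges_mul_congr g f 1 hf
    rw [mul_one] at this
    exact ⟨by rw [this]; exact hA, this⟩
  · intro f _; simp
  · intro f _; simp

open Classical in
lemma ham_sum_translate {N : ℕ} (τ : ZMod N → Equiv.Perm (Fin (N + 1))) [NeZero N]
    (P : Equiv.Perm (Fin (N + 1)) → Prop) :
    ∑ σ : Equiv.Perm (Fin (N + 1)), (Finset.univ.filter fun s => P (σ * τ s)).card =
      N * (Finset.univ.filter P).card := by
  simp only [Finset.card_filter]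
  rw [Finset.sum_comm]
  have : ∀ s, ∑ σ : Equiv.Perm (Fin (N + 1)), (if P (σ * τ s) then 1 else 0) =
      ∑ σ : Equiv.Perm (Fin (N + 1)), (if P σ then 1 else 0) := by
    intro s
    exact Equiv.sum_comp (Equiv.mulRight (τ s)) (fun σ => if P σ then 1 else 0)
  simp only [this, Finset.sum_const, Finset.card_univ, ZMod.card, smul_eq_mul]

lemma zmod_small (N : ℕ) (hN : 4 ≤ N) : (1 : ZMod N) ≠ 0 ∧ (2 : ZMod N) ≠ 0 ∧ (3 : ZMod N) ≠ 0 := by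
  have key : ∀ k : ℕ, 1 ≤ k → k < 4 → ((k : ℕ) : ZMod N) ≠ 0 := by
    intro k h1 h2 h
    rw [ZMod.natCast_eq_zero_iff] at h
    have := Nat.le_of_dvd (by omega) h
    omega
  refine ⟨by simpa using key 1 (by omega) (by omega), by simpa using key 2 (by omega) (by omega),
    by simpa using key 3 (by omega) (by omega)⟩

open Classical in
lemma card_le_two_of_close (N : ℕ) (hN : 4 ≤ N) (S : Finset (ZMod N))
    (h : ∀ a ∈ S, ∀ b ∈ S, a = b ∨ a = b + 1 ∨ b = a + 1) : S.card ≤ 2 := by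
  by_contra hc
  obtain ⟨a, b, c, ha, hb, hcS, hab, hac, hbc⟩ := Finset.two_lt_card_iff.1 (by omega : 2 < S.card)
  obtain ⟨h1, h2, h3⟩ := zmod_small N hN
  rcases h a ha b hb with e | e | e <;> rcases h b hb c hcS with f | f | f <;>
    rcases h a ha c hcS with g | g | g <;> first
    | exact hab e
    | exact hbc f
    | exact hac g
    | exact h1 (by linear_combination e + f - g)
    | exact h1 (by linear_combination e - f - g)
    | exact h1 (by linear_combination e + f + g)
    | exact h1 (by linear_combination e - f + g)
    | exact h1 (by linear_combination -e + f + g)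
    | exact h1 (by linear_combination -e + f - g)
    | exact h1 (by linear_combination -e - f - g)
    | exact h1 (by linear_combination -e - f + g)
    | exact h3 (by linear_combination e + f - g)
    | exact h3 (by linear_combination e - f - g)
    | exact h3 (by linear_combination e + f + g)
    | exact h3 (by linear_combination e - f + g)
    | exact h3 (by linear_combination -e + f + g)
    | exact h3 (by linear_combination -e + f - g)
    | exact h3 (by linear_combination -e - f - g)

open Classical in
theorem ham_main (N : ℕ) (hN : 4 ≤ N) :
    IsEKRFamily (⊤ : SimpleGraph (Fin (N + 1))).edgeSet (cycleFamily (N + 1) (N + 1)) := by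
  have : NeZero N := ⟨by omega⟩
  intro e he ℬ hℬ hint
  rw [cycleFamily_eq (by omega)] at hℬ ⊢
  -- the auxiliary cycles
  have hcard : Fintype.card (Fin (N + 1)) = Fintype.card (Option (ZMod N)) := by simp [ZMod.card]
  let ι : Fin (N + 1) ≃ Option (ZMod N) := Fintype.equivOfCardEq hcard
  have hτ : ∀ s : ZMod N, ∃ τ : Equiv.Perm (Fin (N + 1)), ∀ x y, x ≠ y →
      (s(x, y) ∈ hamEdges τ ↔ (zsum (ι x) (ι y) = s ∨ zsum (ι x) (ι y) = s + 1)) := by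
    intro s
    obtain ⟨z, hz⟩ := exists_shift N (by omega) s
    refine ⟨z.trans ι.symm, fun x y hxy => ?_⟩
    rw [← hz (ι x) (ι y) (by simpa using hxy), mem_hamEdges]
    refine exists_congr fun i => ?_
    rw [← (Sym2.map.injective ι.injective).eq_iff]
    simp
  choose τ hτ using hτ
  -- convert to finsets
  have hfin : ∀ 𝒞 : Set (Finset (Sym2 (Fin (N + 1)))), 𝒞 ⊆ Set.range (hamEdges (N := N)) →
      (Finset.univ.filter fun f => hamEdges (N := N) f ∈ 𝒞).card =
      𝒞.ncard * (Finset.univ.filter fun f => hamEdges (N := N) f = hamEdges 1).card := by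
    intro 𝒞 h𝒞
    rw [Set.ncard_eq_toFinset_card', ← card_fibre]
    · simp
    · intro A hA
      exact h𝒞 (by simpa using hA)
  have hpos : 0 < (Finset.univ.filter fun f => hamEdges (N := N) f = hamEdges 1).card :=
    Finset.card_pos.2 ⟨1, by simp⟩
  refine Nat.le_of_mul_le_mul_right ?_ hpos
  rw [← hfin ℬ hℬ, ← hfin _ (fun A hA => hA.1)]
  refine Nat.le_of_mul_le_mul_left ?_ (show 0 < N by omega)
  rw [← ham_sum_translate τ, ← ham_sum_translate τ]
  refine Finset.sum_le_sum fun σ _ => ?_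
  have hndiag : ∀ f : Equiv.Perm (Fin (N + 1)), ∀ x y, s(x, y) ∈ hamEdges f → x ≠ y := by
    intro f x y h hxy
    subst hxy
    obtain ⟨i, hi⟩ := (mem_hamEdges _ _).1 h
    have hi : f i = f (i + 1) := by
      rcases Sym2.eq_iff.1 hi with ⟨h1, h2⟩ | ⟨h1, h2⟩ <;> rw [h1, h2]
    have := congrArg Fin.val (f.injective hi)
    rw [fin_succ_val, nxt] at this
    split_ifs at this <;> omega
  trans 2
  · apply card_le_two_of_close N hN
    intro a ha b hb
    simp only [Finset.mem_filter, Finset.mem_univ, true_and] at ha hb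
    obtain ⟨d, hda, hdb⟩ := hint _ ha _ hb
    obtain ⟨d, rfl⟩ : ∃ e', Sym2.map σ e' = d := sym2_map_surj σ d
    rw [← mem_hamEdges_mul] at hda hdb
    induction d using Sym2.ind with | _ x y
    have hxy := hndiag _ _ _ hda
    rw [hτ _ _ _ hxy] at hda hdb
    rcases hda with h | h <;> rcases hdb with h' | h'
    · left; rw [← h, ← h']
    · right; left; rw [← h, ← h']
    · right; right; rw [← h, ← h']
    · left; exact add_right_cancel (h.symm.trans h')
  · obtain ⟨d, rfl⟩ : ∃ e', Sym2.map σ e' = e := sym2_map_surj σ e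
    induction d using Sym2.ind with | _ x y
    have hxy : x ≠ y := by simpa using he
    set t := zsum (ι x) (ι y) with ht
    have hne : t ≠ t - 1 := by
      intro h
      exact (zmod_small N hN).1 (by linear_combination h)
    rw [← Finset.card_pair hne]
    refine Finset.card_le_card ?_
    intro s hs
    simp only [Finset.mem_insert, Finset.mem_singleton] at hs
    simp only [Finset.mem_filter, Finset.mem_univ, true_and, famAt, Set.mem_ofPred_eq,
      Set.mem_range_self]
    rw [← mem_hamEdges_mul, hτ _ _ _ hxy]
    rcases hs with rfl | rfl
    · left; rfl
    · right; rw [← ht]; ring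

/-- For every `n ≥ 5`, the family of all Hamiltonian cycles of `K_n` (i.e. cycles of length `n`),
identified with their edge sets, is an EKR family. -/
theorem hamiltonianCycles_isEKR (n : ℕ) (hn : 5 ≤ n) :
    IsEKRFamily (⊤ : SimpleGraph (Fin n)).edgeSet (cycleFamily n n) := by
  obtain ⟨N, rfl⟩ : ∃ N, n = N + 1 := ⟨n - 1, by omega⟩
  exact ham_main N (by omega)
end

section
/- For every integer n ≥ 4, the family ℬ_n(C_{2n}) of all Hamiltonian cycles of the complete bipartite graph K_{n,n}, each identified with its edge set, is an EKR family. -/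
/-- The family of all cycles of length `k` in the complete bipartite graph `K_{n,n}`,
each cycle being identified with its edge set. -/
def bipCycleFamily (n k : ℕ) : Set (Finset (Sym2 (Fin n ⊕ Fin n))) :=
  {E | ∃ (v : Fin n ⊕ Fin n) (w : (completeBipartiteGraph (Fin n) (Fin n)).Walk v v),
      w.IsCycle ∧ w.length = k ∧ E = w.edges.toFinset}

section EKRProof

open Finset

/-- The standard Hamiltonian cycle, relabelled by a pair of permutations. -/
def hamC (m : ℕ) (g : Equiv.Perm (Fin (m + 4)) × Equiv.Perm (Fin (m + 4))) :
    Finset (Sym2 (Fin (m + 4) ⊕ Fin (m + 4))) :=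
  (univ.image fun a => s(Sum.inl (g.1 a), Sum.inr (g.2 a))) ∪
    (univ.image fun a => s(Sum.inl (g.1 a), Sum.inr (g.2 (a + 1))))

lemma mem_hamC {m : ℕ} {g : Equiv.Perm (Fin (m + 4)) × Equiv.Perm (Fin (m + 4))}
    {e : Sym2 (Fin (m + 4) ⊕ Fin (m + 4))} :
    e ∈ hamC m g ↔ ∃ a, e = s(Sum.inl (g.1 a), Sum.inr (g.2 a)) ∨
      e = s(Sum.inl (g.1 a), Sum.inr (g.2 (a + 1))) := by
  simp only [hamC, mem_union, mem_image, mem_univ, true_and, exists_or, eq_comm]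

lemma hamC_mul {m : ℕ} (h g : Equiv.Perm (Fin (m + 4)) × Equiv.Perm (Fin (m + 4))) :
    hamC m (h * g) = (hamC m g).image (Sym2.map (Sum.map h.1 h.2)) := by
  simp only [hamC, image_union, image_image]
  congr 1

lemma hamC_fiber {m : ℕ} (g₀ : Equiv.Perm (Fin (m + 4)) × Equiv.Perm (Fin (m + 4))) :
    #{g | hamC m g = hamC m g₀} = #{g | hamC m g = hamC m 1} := by
  symm
  refine Finset.card_bij (fun g _ => g₀ * g) ?_ ?_ ?_
  · intro g hg
    simp only [mem_filter, mem_univ, true_and] at hg ⊢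
    rw [hamC_mul, hg, ← hamC_mul, mul_one]
  · intro a _ b _ h
    exact mul_left_cancel h
  · intro g hg
    simp only [mem_filter, mem_univ, true_and] at hg
    refine ⟨g₀⁻¹ * g, ?_, by simp⟩
    simp only [mem_filter, mem_univ, true_and]
    rw [hamC_mul, hg, ← hamC_mul, inv_mul_cancel]

/-- Right shift of the second coordinate. -/
def shG (m : ℕ) (i : Fin (m + 4)) : Equiv.Perm (Fin (m + 4)) × Equiv.Perm (Fin (m + 4)) :=
  (1, Equiv.addRight i)

lemma mem_hamC_sh {m : ℕ} {g : Equiv.Perm (Fin (m + 4)) × Equiv.Perm (Fin (m + 4))}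
    {i : Fin (m + 4)} {x y : Fin (m + 4)} :
    s(Sum.inl x, Sum.inr y) ∈ hamC m (g * shG m i) ↔
      (i = g.2.symm y - g.1.symm x ∨ i = g.2.symm y - g.1.symm x - 1) := by
  rw [mem_hamC]
  simp only [shG, Prod.fst_mul, Prod.snd_mul, mul_one, Equiv.Perm.mul_apply,
    Equiv.coe_addRight, Sym2.eq_iff, Sum.inl.injEq, Sum.inr.injEq, reduceCtorEq, and_self, or_false]
  constructor
  · rintro ⟨a, ⟨rfl, rfl⟩ | ⟨rfl, rfl⟩⟩
    · left; simp
    · right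
      simp only [Equiv.symm_apply_apply]; abel
  · rintro (rfl | rfl)
    · refine ⟨g.1.symm x, Or.inl ⟨by simp, by simp⟩⟩
    · refine ⟨g.1.symm x, Or.inr ⟨by simp, ?_⟩⟩
      rw [show g.1.symm x + 1 + (g.2.symm y - g.1.symm x - 1) = g.2.symm y by abel]
      simp

lemma hamC_count {m : ℕ} (P : Finset (Sym2 (Fin (m + 4) ⊕ Fin (m + 4))) → Prop)
    [DecidablePred P] :
    (m + 4) * #{g | P (hamC m g)} = ∑ g, #{i | P (hamC m (g * shG m i))} := by
  have h1 : ∀ i, #{g | P (hamC m (g * shG m i))} = #{g | P (hamC m g)} := by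
    intro i
    refine Finset.card_bij (fun g _ => g * shG m i) ?_ ?_ ?_
    · intro g hg
      simpa using hg
    · intro a _ b _ h
      exact mul_right_cancel h
    · intro g hg
      exact ⟨g * (shG m i)⁻¹, by simpa using hg, by simp⟩
  simp only [card_filter] at h1 ⊢
  rw [Finset.sum_comm, Finset.sum_congr rfl (fun i _ => h1 i)]
  simp

lemma fin_aux {m : ℕ} (s : Finset (Fin (m + 4)))
    (hs : ∀ i ∈ s, ∀ j ∈ s, i = j ∨ i = j + 1 ∨ j = i + 1) : #s ≤ 2 := by
  by_contra hc
  obtain ⟨a, ha, b, hb, c, hc, hab, hac, hbc⟩ := Finset.two_lt_card.1 (not_le.1 hc)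
  have h1 := hs a ha b hb
  have h2 := hs a ha c hc
  have h3 := hs b hb c hc
  simp only [Fin.ext_iff, Fin.val_add_one, Fin.val_last, ne_eq] at *
  have := a.2
  have := b.2
  have := c.2
  split_ifs at * <;> omega

lemma hamC_inter {m : ℕ} {g : Equiv.Perm (Fin (m + 4)) × Equiv.Perm (Fin (m + 4))}
    {i j : Fin (m + 4)} {e} (h1 : e ∈ hamC m (g * shG m i)) (h2 : e ∈ hamC m (g * shG m j)) :
    i = j ∨ i = j + 1 ∨ j = i + 1 := by
  obtain ⟨x, y, rfl⟩ : ∃ x y, e = s(Sum.inl x, Sum.inr y) := by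
    obtain ⟨a, h | h⟩ := mem_hamC.1 h1
    exacts [⟨_, _, h⟩, ⟨_, _, h⟩]
  rw [mem_hamC_sh] at h1 h2
  rcases h1 with h1 | h1 <;> rcases h2 with h2 | h2 <;> subst h1 h2 <;> simp

/-- A sequence of adjacent vertices gives a walk. -/
lemma exists_walk_of_seq {V : Type*} {G : SimpleGraph V} (p : ℕ → V)
    (hp : ∀ i, G.Adj (p i) (p (i + 1))) (k : ℕ) :
    ∃ w : G.Walk (p 0) (p k), w.length = k ∧ w.support = (List.range (k + 1)).map p ∧
      w.edges = (List.range k).map fun i => s(p i, p (i + 1)) := by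
  induction k with
  | zero => exact ⟨.nil, by simp⟩
  | succ k ih =>
    obtain ⟨w, h1, h2, h3⟩ := ih
    refine ⟨w.concat (hp k), by simp [h1], ?_, ?_⟩
    · rw [SimpleGraph.Walk.support_concat, h2, List.range_succ (n := k + 1)]; simp
    · rw [SimpleGraph.Walk.edges_concat, h3, List.range_succ (n := k)]; simp

/-- The vertex sequence of the standard cycle. -/
def hamSeq (m : ℕ) (g : Equiv.Perm (Fin (m + 4)) × Equiv.Perm (Fin (m + 4))) (j : ℕ) :
    Fin (m + 4) ⊕ Fin (m + 4) :=
  if j % 2 = 0 then Sum.inl (g.1 (Fin.ofNat (m + 4) (j / 2)))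
  else Sum.inr (g.2 (Fin.ofNat (m + 4) (j / 2 + 1)))

lemma ofNat_succ' (m k : ℕ) : Fin.ofNat (m + 4) (k + 1) = Fin.ofNat (m + 4) k + 1 := by
  ext
  simp [Fin.val_add]

lemma hamSeq_even (m : ℕ) (g) (k : ℕ) :
    hamSeq m g (2 * k) = Sum.inl (g.1 (Fin.ofNat (m + 4) k)) := by
  simp [hamSeq]

lemma hamSeq_odd (m : ℕ) (g) (k : ℕ) :
    hamSeq m g (2 * k + 1) = Sum.inr (g.2 (Fin.ofNat (m + 4) k + 1)) := by
  have h : (2 * k + 1) / 2 = k := by omega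
  have h2 : (2 * k + 1) % 2 ≠ 0 := by omega
  rw [hamSeq, if_neg h2, h, ofNat_succ']

lemma ofNat_inj' {m a b : ℕ} (h : Fin.ofNat (m + 4) a = Fin.ofNat (m + 4) b) :
    a % (m + 4) = b % (m + 4) := by
  simpa [Fin.ext_iff] using h

lemma hamSeq_edges (m : ℕ) (g) :
    ((List.range (2 * (m + 4))).map fun i => s(hamSeq m g i, hamSeq m g (i + 1))).toFinset
      = hamC m g := by
  ext e
  rw [mem_hamC]
  simp only [List.mem_toFinset, List.mem_map, List.mem_range]
  constructor
  · rintro ⟨j, hj, rfl⟩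
    rcases Nat.even_or_odd' j with ⟨k, rfl | rfl⟩
    · refine ⟨Fin.ofNat (m + 4) k, Or.inr ?_⟩
      rw [hamSeq_even, hamSeq_odd]
    · refine ⟨Fin.ofNat (m + 4) k + 1, Or.inl ?_⟩
      rw [hamSeq_odd, show 2 * k + 1 + 1 = 2 * (k + 1) by ring, hamSeq_even, ofNat_succ',
        Sym2.eq_swap]
  · rintro ⟨a, rfl | rfl⟩
    · refine ⟨2 * (a - 1 : Fin (m + 4)).val + 1, by have := (a - 1 : Fin (m + 4)).2; omega, ?_⟩
      rw [hamSeq_odd, show ∀ k, 2 * k + 1 + 1 = 2 * (k + 1) by intro k; ring, hamSeq_even,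
        ofNat_succ', Sym2.eq_swap]
      simp
    · refine ⟨2 * a.val, by have := a.2; omega, ?_⟩
      rw [hamSeq_even, hamSeq_odd]
      simp

lemma hamSeq_adj (m : ℕ) (g) (i : ℕ) :
    (completeBipartiteGraph (Fin (m + 4)) (Fin (m + 4))).Adj (hamSeq m g i)
      (hamSeq m g (i + 1)) := by
  rcases Nat.even_or_odd' i with ⟨k, rfl | rfl⟩
  · rw [hamSeq_even, hamSeq_odd]; simp
  · rw [hamSeq_odd, show 2 * k + 1 + 1 = 2 * (k + 1) by ring, hamSeq_even]; simp

lemma hamSeq_inj (m : ℕ) (g) {i j : ℕ} (hi : i < 2 * (m + 4)) (hj : j < 2 * (m + 4))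
    (h : hamSeq m g (i + 1) = hamSeq m g (j + 1)) : i = j := by
  have key : ∀ k l, k < m + 4 → l < m + 4 →
      Fin.ofNat (m + 4) k = Fin.ofNat (m + 4) l → k = l := by
    intro k l hk hl h
    have := ofNat_inj' h
    rwa [Nat.mod_eq_of_lt hk, Nat.mod_eq_of_lt hl] at this
  rcases Nat.even_or_odd' i with ⟨k, rfl | rfl⟩ <;> rcases Nat.even_or_odd' j with ⟨l, rfl | rfl⟩
  · simp only [hamSeq_odd, Sum.inr.injEq, EmbeddingLike.apply_eq_iff_eq, add_left_inj] at h
    rw [key k l (by omega) (by omega) h]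
  · rw [hamSeq_odd, show 2 * l + 1 + 1 = 2 * (l + 1) by ring, hamSeq_even] at h
    cases h
  · rw [hamSeq_odd, show 2 * k + 1 + 1 = 2 * (k + 1) by ring, hamSeq_even] at h
    cases h
  · rw [show 2 * k + 1 + 1 = 2 * (k + 1) by ring, show 2 * l + 1 + 1 = 2 * (l + 1) by ring] at h
    simp only [hamSeq_even, ofNat_succ', Sum.inl.injEq, EmbeddingLike.apply_eq_iff_eq,
      add_left_inj] at h
    rw [key k l (by omega) (by omega) h]

lemma hamC_mem (m : ℕ) (g) : hamC m g ∈ bipCycleFamily (m + 4) (2 * (m + 4)) := by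
  obtain ⟨w, h1, h2, h3⟩ := exists_walk_of_seq (hamSeq m g) (hamSeq_adj m g) (2 * (m + 4))
  have h0 : hamSeq m g (2 * (m + 4)) = hamSeq m g 0 := by
    rw [hamSeq_even, show (0 : ℕ) = 2 * 0 by rfl, hamSeq_even]
    congr 2
    ext; simp
  refine ⟨hamSeq m g 0, w.copy rfl h0, ?_, by simpa using h1, ?_⟩
  · rw [SimpleGraph.Walk.isCycle_iff_isPath_tail_and_le_length]
    have hl : (w.copy rfl h0).length = 2 * (m + 4) := by simpa using h1
    refine ⟨?_, by omega⟩
    rw [SimpleGraph.Walk.isPath_def, SimpleGraph.Walk.support_tail_of_not_nil]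
    · rw [SimpleGraph.Walk.support_copy, h2, List.range_succ_eq_map]
      simp only [List.map_cons, List.tail_cons, List.map_map]
      refine List.Nodup.map_on ?_ List.nodup_range
      intro x hx y hy hxy
      exact hamSeq_inj m g (List.mem_range.1 hx) (List.mem_range.1 hy) hxy
    · intro hn
      have := SimpleGraph.Walk.length_eq_zero_iff.2 hn
      omega
  · rw [SimpleGraph.Walk.edges_copy, h3, hamSeq_edges]

lemma exists_hamC_inl (m : ℕ) (v : Fin (m + 4))
    (w : (completeBipartiteGraph (Fin (m + 4)) (Fin (m + 4))).Walk (Sum.inl v) (Sum.inl v))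
    (hw : w.IsCycle) (hl : w.length = 2 * (m + 4)) :
    ∃ g, w.edges.toFinset = hamC m g := by
  have hpar : ∀ k, k ≤ m + 4 → ∃ a, w.getVert (2 * k) = Sum.inl a := by
    intro k
    induction k with
    | zero => intro _; exact ⟨v, by simp⟩
    | succ k ih =>
      intro hk
      obtain ⟨a, ha⟩ := ih (by omega)
      have e1 := w.adj_getVert_succ (i := 2 * k) (by omega)
      have e2 := w.adj_getVert_succ (i := 2 * k + 1) (by omega)
      rw [ha] at e1
      rw [show 2 * (k + 1) = 2 * k + 1 + 1 by ring]
      generalize w.getVert (2 * k + 1) = b at *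
      generalize w.getVert (2 * k + 1 + 1) = c at *
      rcases b with b | b <;> rcases c with c | c <;> simp at *
  have hpar2 : ∀ k, k < m + 4 → ∃ a, w.getVert (2 * k + 1) = Sum.inr a := by
    intro k hk
    obtain ⟨a, ha⟩ := hpar k hk.le
    have e1 := w.adj_getVert_succ (i := 2 * k) (by omega)
    rw [ha] at e1
    generalize w.getVert (2 * k + 1) = b at *
    rcases b with b | b <;> simp at *
  choose f hf using fun k : Fin (m + 4) => hpar k.val k.2.le
  choose f' hf' using fun k : Fin (m + 4) => hpar2 k.val k.2
  have hinj := hw.getVert_injOn'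
  have fi : Function.Injective f := by
    intro a b hab
    have : w.getVert (2 * a.val) = w.getVert (2 * b.val) := by rw [hf, hf, hab]
    have := hinj (by simp; omega) (by simp; omega) this
    ext; omega
  have fi' : Function.Injective f' := by
    intro a b hab
    have : w.getVert (2 * a.val + 1) = w.getVert (2 * b.val + 1) := by rw [hf', hf', hab]
    have := hinj (by simp; omega) (by simp; omega) this
    ext; omega
  let σ : Equiv.Perm (Fin (m + 4)) := Equiv.ofBijective f (Finite.injective_iff_bijective.1 fi)
  let τ' : Equiv.Perm (Fin (m + 4)) := Equiv.ofBijective f' (Finite.injective_iff_bijective.1 fi')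
  let τ : Equiv.Perm (Fin (m + 4)) := (Equiv.subRight 1).trans τ'
  refine ⟨(σ, τ), ?_⟩
  have hseq : ∀ j, j ≤ 2 * (m + 4) → w.getVert j = hamSeq m (σ, τ) j := by
    intro j hj
    rcases Nat.even_or_odd' j with ⟨k, rfl | rfl⟩
    · rw [hamSeq_even]
      rcases Nat.lt_or_ge k (m + 4) with hk | hk
      · have : Fin.ofNat (m + 4) k = ⟨k, hk⟩ := by ext; simp [Nat.mod_eq_of_lt hk]
        rw [this]
        exact hf ⟨k, hk⟩
      · obtain rfl : k = m + 4 := by omega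
        have : Fin.ofNat (m + 4) (m + 4) = ⟨0, by omega⟩ := by ext; simp
        rw [this, ← hl, SimpleGraph.Walk.getVert_length]
        have := hf ⟨0, by omega⟩
        simpa [σ] using this
    · rw [hamSeq_odd]
      have hk : k < m + 4 := by omega
      have : Fin.ofNat (m + 4) k = ⟨k, hk⟩ := by ext; simp [Nat.mod_eq_of_lt hk]
      rw [this, hf' ⟨k, hk⟩]
      simp [τ, τ']
  rw [← hamSeq_edges]
  congr 1
  apply List.ext_getElem
  · simp [hl]
  · intro i h1 h2
    have hi : i < 2 * (m + 4) := by simpa using h2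
    rw [SimpleGraph.Walk.getElem_edges_eq_edge_getElem_darts]
    simp [hseq i (by omega), hseq (i + 1) (by omega), SimpleGraph.Walk.darts_getElem_eq_getVert,
      SimpleGraph.Dart.edge]

lemma exists_hamC (m : ℕ) (E) (hE : E ∈ bipCycleFamily (m + 4) (2 * (m + 4))) :
    ∃ g, E = hamC m g := by
  obtain ⟨v, w, hw, hl, rfl⟩ := hE
  rcases v with v | v
  · exact exists_hamC_inl m v w hw hl
  · have e1 := w.adj_getVert_succ (i := 0) (by omega)
    have hmem : w.getVert 1 ∈ w.support := w.getVert_mem_support 1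
    obtain ⟨u, hu⟩ : ∃ u, w.getVert 1 = Sum.inl u := by
      rw [w.getVert_zero, zero_add] at e1
      generalize w.getVert 1 = b at *
      rcases b with b | b <;> simp at *
    rw [hu] at hmem
    obtain ⟨g, hg⟩ := exists_hamC_inl m u (w.rotate _ hmem)
      ((SimpleGraph.Walk.isCycle_rotate hmem).2 hw) (by
        rw [← hl, ← SimpleGraph.Walk.length_edges, ← SimpleGraph.Walk.length_edges]
        exact (w.rotate_edges _ hmem).perm.length_eq)
    refine ⟨g, hg ▸ ?_⟩
    exact (List.toFinset_eq_of_perm _ _ (w.rotate_edges _ hmem).perm).symm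

lemma hamC_preimage {m : ℕ} (S : Finset (Finset (Sym2 (Fin (m + 4) ⊕ Fin (m + 4)))))
    (hS : ∀ E ∈ S, E ∈ bipCycleFamily (m + 4) (2 * (m + 4))) :
    #{g | hamC m g ∈ S} = #S * #{g | hamC m g = hamC m 1} := by
  rw [Finset.card_eq_sum_card_fiberwise (f := hamC m) (t := S) (by intro g hg; simpa using hg)]
  rw [Finset.sum_const_nat]
  intro E hE
  obtain ⟨g₀, rfl⟩ := exists_hamC m E (hS E hE)
  rw [← hamC_fiber g₀, Finset.filter_filter]
  congr 1
  ext g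
  simp only [mem_filter, mem_univ, true_and, and_iff_right_iff_imp]
  intro h
  rwa [h]

end EKRProof

/-- For every `n ≥ 4`, the family of all Hamiltonian cycles of `K_{n,n}` (i.e. cycles of
length `2n`), identified with their edge sets, is an EKR family. -/
theorem bipHamiltonianCycles_isEKR (n : ℕ) (hn : 4 ≤ n) :
    IsEKRFamily (completeBipartiteGraph (Fin n) (Fin n)).edgeSet (bipCycleFamily n (2 * n)) := by
  classical
  obtain ⟨m, rfl⟩ : ∃ m, n = m + 4 := ⟨n - 4, by omega⟩
  intro e he ℬ hB hI
  obtain ⟨x, y, rfl⟩ : ∃ x y, e = s(Sum.inl x, Sum.inr y) := by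
    induction e using Sym2.ind with
    | _ a b =>
      rw [SimpleGraph.mem_edgeSet] at he
      rcases a with a | a <;> rcases b with b | b <;> simp at he
      · exact ⟨a, b, rfl⟩
      · exact ⟨b, a, Sym2.eq_swap⟩
  set 𝒜 := bipCycleFamily (m + 4) (2 * (m + 4)) with hA
  rw [Set.ncard_eq_toFinset_card' ℬ, Set.ncard_eq_toFinset_card' (famAt 𝒜 _)]
  have hpos : 0 < (Finset.univ.filter fun g => hamC m g = hamC m 1).card :=
    Finset.card_pos.2 ⟨1, by simp⟩
  have p1 := hamC_preimage ℬ.toFinset (fun E hE => hB (by simpa using hE))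
  have p2 := hamC_preimage (famAt 𝒜 s(Sum.inl x, Sum.inr y)).toFinset
    (fun E hE => by
      have : E ∈ famAt 𝒜 s(Sum.inl x, Sum.inr y) := by simpa using hE
      exact this.1)
  refine Nat.le_of_mul_le_mul_right ?_ hpos
  rw [← p1, ← p2]
  refine Nat.le_of_mul_le_mul_left ?_ (show 0 < m + 4 by omega)
  rw [hamC_count (fun E => E ∈ ℬ.toFinset),
    hamC_count (fun E => E ∈ (famAt 𝒜 s(Sum.inl x, Sum.inr y)).toFinset)]
  refine Finset.sum_le_sum fun g _ => le_trans (b := 2) ?_ (le_of_eq ?_)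
  · refine fin_aux _ fun i hi j hj => ?_
    simp only [Set.mem_toFinset, Finset.mem_filter, Finset.mem_univ, true_and] at hi hj
    obtain ⟨z, h1, h2⟩ := hI _ hi _ hj
    exact hamC_inter h1 h2
  · symm
    rw [Finset.card_eq_two]
    refine ⟨g.2.symm y - g.1.symm x, g.2.symm y - g.1.symm x - 1, ?_, ?_⟩
    · intro h
      have h3 := congrArg (fun t => t - (g.2.symm y - g.1.symm x) + 1) h
      simp at h3
    · ext i
      have hm : ∀ g', hamC m g' ∈ 𝒜 := hamC_mem m
      have hf : ∀ E, E ∈ famAt 𝒜 s(Sum.inl x, Sum.inr y) ↔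
          E ∈ 𝒜 ∧ s(Sum.inl x, Sum.inr y) ∈ E := fun E => Iff.rfl
      rw [Finset.mem_filter, Set.mem_toFinset, hf, mem_hamC_sh]
      simp only [Finset.mem_univ, true_and, hm, Finset.mem_insert, Finset.mem_singleton]
end

section
/- For every integer n ≥ 6, the family ℱ_n(C_3) of all 3-cycles (triangles) in the complete graph K_n is an EKR family, and for every integer n ≥ 7 it is a strong EKR family. -/
open Finset in
/-- edge set of the complete graph on `S` -/
def triE {n : ℕ} (S : Finset (Fin n)) : Finset (Sym2 (Fin n)) :=
  S.sym2.filter (fun e => ¬ e.IsDiag)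

theorem mem_triE {n : ℕ} (S : Finset (Fin n)) (x y : Fin n) :
    s(x, y) ∈ triE S ↔ x ∈ S ∧ y ∈ S ∧ x ≠ y := by
  simp [triE, and_assoc]

theorem triE_inj {n : ℕ} {S T : Finset (Fin n)} (hS : S.card = 3) (hT : T.card = 3)
    (h : triE S = triE T) : S = T := by
  refine Finset.eq_of_subset_of_card_le (fun x hx => ?_) (by omega)
  obtain ⟨y, hy, hyx⟩ := Finset.exists_mem_ne (by omega : 1 < S.card) x
  have : s(x, y) ∈ triE S := (mem_triE S x y).2 ⟨hx, hy, hyx.symm⟩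
  rw [h, mem_triE] at this
  exact this.1

theorem triE_eq {n : ℕ} (a b c : Fin n) (h1 : a ≠ b) (h2 : b ≠ c) (h3 : c ≠ a) :
    triE {a, b, c} = {s(a, b), s(b, c), s(c, a)} := by
  ext e
  induction e with
  | _ x y =>
    rw [mem_triE]
    simp only [Finset.mem_insert, Finset.mem_singleton, Sym2.eq_iff]
    grind

theorem cycleFamily_eq_s5 (n : ℕ) :
    cycleFamily n 3 = triE '' {S : Finset (Fin n) | S.card = 3} := by
  ext E
  constructor
  · rintro ⟨v, w, hc, hl, rfl⟩
    match w, hc, hl with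
    | .cons (v := a) h1 (.cons (v := b) h2 (.cons h3 .nil)), hc, hl =>
      simp only [SimpleGraph.top_adj] at h1 h2 h3
      refine ⟨{v, a, b}, ?_, ?_⟩
      · exact Finset.card_eq_three.2 ⟨v, a, b, h1, h3.symm, h2, rfl⟩
      · rw [triE_eq _ _ _ h1 h2 h3]
        simp
  · rintro ⟨S, hS, rfl⟩
    obtain ⟨a, b, c, hab, hac, hbc, rfl⟩ := Finset.card_eq_three.1 hS
    refine ⟨a, .cons (v := b) (by simpa) (.cons (v := c) (by simpa)
      (.cons (by simpa using hac.symm) .nil)), ?_, rfl, ?_⟩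
    · simp [SimpleGraph.Walk.isCycle_def, SimpleGraph.Walk.isTrail_def]
      grind
    · rw [triE_eq _ _ _ hab hbc hac.symm]
      simp

theorem famAt_eq (n : ℕ) (x y : Fin n) (h : x ≠ y) :
    famAt (cycleFamily n 3) s(x, y) =
      (fun z => triE {x, y, z}) '' (({x, y} : Finset (Fin n))ᶜ : Finset (Fin n)) := by
  rw [cycleFamily_eq_s5]
  ext E
  constructor
  · rintro ⟨⟨S, hS, rfl⟩, hE⟩
    rw [mem_triE] at hE
    obtain ⟨a, b, c, hab, hac, hbc, rfl⟩ := Finset.card_eq_three.1 hS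
    have : ∃ z, z ≠ x ∧ z ≠ y ∧ ({a, b, c} : Finset (Fin n)) = {x, y, z} := by
      simp only [Finset.mem_insert, Finset.mem_singleton] at hE
      obtain ⟨h1, h2, -⟩ := hE
      rcases h1 with rfl | rfl | rfl <;> rcases h2 with rfl | rfl | rfl <;>
        first
        | exact absurd rfl h
        | exact ⟨a, by grind⟩
        | exact ⟨b, by grind⟩
        | exact ⟨c, by grind⟩
    obtain ⟨z, hzx, hzy, hz⟩ := this
    exact ⟨z, by simp [hzx, hzy], by simp only [hz]⟩
  · rintro ⟨z, hz, rfl⟩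
    simp at hz
    refine ⟨⟨_, ?_, rfl⟩, ?_⟩
    · exact Finset.card_eq_three.2 ⟨x, y, z, h, by grind, by grind, rfl⟩
    · simp [mem_triE, h]

theorem famAt_ncard (n : ℕ) (x y : Fin n) (h : x ≠ y) :
    (famAt (cycleFamily n 3) s(x, y)).ncard = n - 2 := by
  rw [famAt_eq n x y h, Set.ncard_image_of_injOn, Set.ncard_coe_finset,
    Finset.card_compl, Finset.card_pair h, Fintype.card_fin]
  intro z hz w hw hzw
  simp at hz hw
  have := triE_inj (Finset.card_eq_three.2 ⟨x, y, z, h, by grind, by grind, rfl⟩)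
    (Finset.card_eq_three.2 ⟨x, y, w, h, by grind, by grind, rfl⟩) hzw
  have h2 : z ∈ ({x, y, w} : Finset (Fin n)) := by rw [← this]; simp
  simp at h2
  grind

theorem four_aux {n : ℕ} {x y a b : Fin n} {C : Finset (Fin n)} (hC : C.card = 3)
    (hxa : x ≠ a) (hya : y ≠ a) (hxb : x ≠ b) (hyb : y ≠ b) (hab : a ≠ b)
    (hA : ∃ u v, u ≠ v ∧ u ∈ C ∧ v ∈ C ∧ u ∈ ({x, y, a} : Finset (Fin n)) ∧
      v ∈ ({x, y, a} : Finset (Fin n)))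
    (hB : ∃ u v, u ≠ v ∧ u ∈ C ∧ v ∈ C ∧ u ∈ ({x, y, b} : Finset (Fin n)) ∧
      v ∈ ({x, y, b} : Finset (Fin n)))
    (hn : ¬ (x ∈ C ∧ y ∈ C)) : C = {x, a, b} ∨ C = {y, a, b} := by
  have key : a ∈ C ∧ b ∈ C ∧ (x ∈ C ∨ y ∈ C) := by grind
  obtain ⟨ha, hb, hx | hy⟩ := key
  · left
    symm
    apply Finset.eq_of_subset_of_card_le
    · intro; grind
    · rw [hC, Finset.card_eq_three.2 ⟨x, a, b, hxa, hxb, hab, rfl⟩]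
  · right
    symm
    apply Finset.eq_of_subset_of_card_le
    · intro; grind
    · rw [hC, Finset.card_eq_three.2 ⟨y, a, b, hya, hyb, hab, rfl⟩]

theorem sub_four {n : ℕ} {x y a b : Fin n} {C D : Finset (Fin n)} (hD : D.card = 3)
    (hxy : x ≠ y) (hxa : x ≠ a) (hya : y ≠ a) (hxb : x ≠ b) (hyb : y ≠ b)
    (hxD : x ∈ D) (hyD : y ∈ D)
    (hC : C = {x, a, b} ∨ C = {y, a, b})
    (hCD : ∃ u v, u ≠ v ∧ u ∈ D ∧ v ∈ D ∧ u ∈ C ∧ v ∈ C) : D ⊆ {x, y, a, b} := by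
  have h3 : ∃ c, c ∈ D ∧ c ≠ x ∧ c ≠ y ∧ (c = a ∨ c = b) := by
    obtain ⟨u, v, huv, h1, h2, h3, h4⟩ := hCD
    by_cases hu : u = x ∨ u = y
    · exact ⟨v, by grind⟩
    · exact ⟨u, by grind⟩
  obtain ⟨c, hc, hcx, hcy, hcab⟩ := h3
  have : ({x, y, c} : Finset (Fin n)) = D := by
    apply Finset.eq_of_subset_of_card_le
    · intro; grind
    · rw [hD, Finset.card_eq_three.2 ⟨x, y, c, hxy, hcx.symm, hcy.symm, rfl⟩]
  rw [← this]
  intro; grind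

theorem key_struct {n : ℕ} (hn : 2 ≤ n) (𝒮 : Set (Finset (Fin n)))
    (h3 : ∀ S ∈ 𝒮, S.card = 3)
    (hI : ∀ S ∈ 𝒮, ∀ T ∈ 𝒮, ∃ u v, u ≠ v ∧ u ∈ S ∧ v ∈ S ∧ u ∈ T ∧ v ∈ T) :
    (∃ x y, x ≠ y ∧ ∀ S ∈ 𝒮, x ∈ S ∧ y ∈ S) ∨
    ∃ Q : Finset (Fin n), Q.card = 4 ∧ ∀ S ∈ 𝒮, S ⊆ Q := by
  by_cases hne : ∃ A ∈ 𝒮, ∃ B ∈ 𝒮, A ≠ B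
  · obtain ⟨A, hA, B, hB, hAB⟩ := hne
    obtain ⟨x, y, hxy, hxA, hyA, hxB, hyB⟩ := hI A hA B hB
    have ext3 : ∀ S ∈ 𝒮, x ∈ S → y ∈ S → ∃ a, x ≠ a ∧ y ≠ a ∧ S = {x, y, a} := by
      intro S hS hx hy
      have hc : ((S.erase x).erase y).card = 1 := by
        rw [Finset.card_erase_of_mem (by grind), Finset.card_erase_of_mem hx, h3 S hS]
      obtain ⟨a, ha⟩ := Finset.card_eq_one.1 hc
      have hm : ∀ z, z ∈ (S.erase x).erase y ↔ z = a := by simp [ha]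
      simp only [Finset.mem_erase] at hm
      clear ha hc h3 hI hAB
      have hma := (hm a).2 rfl
      refine ⟨a, by grind, by grind, ?_⟩
      ext z
      have := hm z
      grind
    obtain ⟨a, hxa, hya, rfl⟩ := ext3 A hA hxA hyA
    obtain ⟨b, hxb, hyb, rfl⟩ := ext3 B hB hxB hyB
    have hab : a ≠ b := by rintro rfl; exact hAB rfl
    by_cases hc : ∀ S ∈ 𝒮, x ∈ S ∧ y ∈ S
    · exact Or.inl ⟨x, y, hxy, hc⟩
    · push Not at hc
      obtain ⟨C, hC, hCn⟩ := hc
      have aux : ∀ C ∈ 𝒮, ¬ (x ∈ C ∧ y ∈ C) → C = {x, a, b} ∨ C = {y, a, b} :=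
        fun C hC hn => four_aux (h3 C hC) hxa hya hxb hyb hab
          (hI C hC _ hA) (hI C hC _ hB) hn
      right
      refine ⟨{x, y, a, b}, ?_, fun D hD => ?_⟩
      · rw [Finset.card_insert_of_notMem (by grind),
          Finset.card_eq_three.2 ⟨y, a, b, hya, hyb, hab, rfl⟩]
      · by_cases hd : x ∈ D ∧ y ∈ D
        · exact sub_four (h3 D hD) hxy hxa hya hxb hyb hd.1 hd.2 (aux C hC (by tauto)) (hI D hD C hC)
        · rcases aux D hD hd with rfl | rfl <;> intro <;> grind
  · push Not at hne
    left
    rcases 𝒮.eq_empty_or_nonempty with rfl | ⟨A, hA⟩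
    · exact ⟨⟨0, by omega⟩, ⟨1, by omega⟩, by simp, by simp⟩
    · obtain ⟨u, v, huv, hu, hv, -⟩ := hI A hA A hA
      exact ⟨u, v, huv, fun S hS => hne A hA S hS ▸ ⟨hu, hv⟩⟩

theorem key_fam {n : ℕ} (hn : 2 ≤ n) (ℬ : Set (Finset (Sym2 (Fin n))))
    (hB : ℬ ⊆ cycleFamily n 3) (hI : IsIntersectingFamily ℬ) :
    (∃ x y, x ≠ y ∧ ℬ ⊆ famAt (cycleFamily n 3) s(x, y)) ∨ ℬ.ncard ≤ 4 := by
  have hB' := hB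
  rw [cycleFamily_eq_s5] at hB'
  rcases key_struct hn {S | S.card = 3 ∧ triE S ∈ ℬ} (fun S h => h.1) (by
    rintro S ⟨-, hS⟩ T ⟨-, hT⟩
    obtain ⟨e, he⟩ := hI _ hS _ hT
    induction e with
    | _ x y =>
      rw [mem_triE, mem_triE] at he
      exact ⟨x, y, by tauto⟩) with ⟨x, y, hxy, h⟩ | ⟨Q, hQ, h⟩
  · refine Or.inl ⟨x, y, hxy, fun E hE => ⟨hB hE, ?_⟩⟩
    obtain ⟨S, hS, rfl⟩ := hB' hE
    have := h S ⟨hS, hE⟩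
    exact (mem_triE S x y).2 ⟨this.1, this.2, hxy⟩
  · right
    have hsub : ℬ ⊆ ((Q.powersetCard 3).image triE : Finset _) := by
      intro E hE
      obtain ⟨S, hS, rfl⟩ := hB' hE
      simp only [Finset.coe_image, Set.mem_image, Finset.mem_coe, Finset.mem_powersetCard]
      exact ⟨S, ⟨h S ⟨hS, hE⟩, hS⟩, rfl⟩
    calc ℬ.ncard ≤ _ := Set.ncard_le_ncard hsub (Finset.finite_toSet _)
      _ = _ := Set.ncard_coe_finset _
      _ ≤ _ := Finset.card_image_le
      _ = 4 := by rw [Finset.card_powersetCard, hQ]; rfl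

theorem ekr_part (n : ℕ) (hn : 6 ≤ n) :
    IsEKRFamily (⊤ : SimpleGraph (Fin n)).edgeSet (cycleFamily n 3) := by
  intro e he ℬ hB hI
  induction e with
  | _ p q =>
    have hpq : p ≠ q := by simpa using he
    rw [famAt_ncard n p q hpq]
    rcases key_fam (by omega) ℬ hB hI with ⟨x, y, hxy, h⟩ | h
    · rw [← famAt_ncard n x y hxy]
      exact Set.ncard_le_ncard h (Set.toFinite _)
    · omega

/-- For every `n ≥ 6` the family of all triangles (3-cycles) of `K_n` is an EKR family,
and for every `n ≥ 7` it is a strong EKR family. -/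
theorem triangles_EKR (n : ℕ) :
    (6 ≤ n → IsEKRFamily (⊤ : SimpleGraph (Fin n)).edgeSet (cycleFamily n 3)) ∧
    (7 ≤ n → IsStrongEKRFamily (⊤ : SimpleGraph (Fin n)).edgeSet (cycleFamily n 3)) := by
  refine ⟨ekr_part n, fun hn => ⟨ekr_part n (by omega), fun ℬ hB hI hmax => ?_⟩⟩
  have h01 : (⟨0, by omega⟩ : Fin n) ≠ ⟨1, by omega⟩ := by simp
  have hge := hmax (famAt (cycleFamily n 3) s(⟨0, by omega⟩, ⟨1, by omega⟩))
    (fun E hE => hE.1) (fun A hA B hB => ⟨_, hA.2, hB.2⟩)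
  rw [famAt_ncard n _ _ h01] at hge
  rcases key_fam (by omega) ℬ hB hI with ⟨x, y, hxy, h⟩ | h
  · refine ⟨s(x, y), by simpa using hxy, ?_⟩
    refine Set.eq_of_subset_of_ncard_le h ?_ (Set.toFinite _)
    rw [famAt_ncard n x y hxy]
    exact hge
  · omega
end

section
/- For every integer n ≥ 24, the family ℱ_n(C_4) of all 4-cycles in the complete graph K_n is an EKR family and moreover a strong EKR family. -/
/-- The edge set of the 4-cycle `a b c d`. -/
def cyc4 {n : ℕ} (a b c d : Fin n) : Finset (Sym2 (Fin n)) :=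
  {s(a, b), s(b, c), s(c, d), s(d, a)}

/-- The four vertices are pairwise distinct. -/
def Dist4 {n : ℕ} (a b c d : Fin n) : Prop :=
  a ≠ b ∧ a ≠ c ∧ a ≠ d ∧ b ≠ c ∧ b ≠ d ∧ c ≠ d

theorem mem_cycleFamily_four {n : ℕ} (E : Finset (Sym2 (Fin n))) :
    E ∈ cycleFamily n 4 ↔ ∃ a b c d, Dist4 a b c d ∧ E = cyc4 a b c d := by
  constructor
  · rintro ⟨v, w, hw, hl, rfl⟩
    match v, w, hl with
    | v, .cons (v := b) h1 (.cons (v := c) h2 (.cons (v := d) h3 (.cons h4 .nil))), _ =>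
      refine ⟨v, b, c, d, ?_, ?_⟩
      · have := hw.support_nodup
        simp at this h1 h2 h3 h4
        unfold Dist4
        grind
      · ext x
        simp [cyc4]
  · rintro ⟨a, b, c, d, ⟨h1, h2, h3, h4, h5, h6⟩, rfl⟩
    have e1 : (⊤ : SimpleGraph (Fin n)).Adj a b := by simpa using h1
    have e2 : (⊤ : SimpleGraph (Fin n)).Adj b c := by simpa using h4
    have e3 : (⊤ : SimpleGraph (Fin n)).Adj c d := by simpa using h6
    have e4 : (⊤ : SimpleGraph (Fin n)).Adj d a := by simpa using h3.symm
    refine ⟨a, .cons e1 (.cons e2 (.cons e3 (.cons e4 .nil))), ?_, ?_, ?_⟩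
    · rw [SimpleGraph.Walk.cons_isCycle_iff]
      simp [SimpleGraph.Walk.isPath_def]
      grind
    · simp
    · ext x
      simp [cyc4]

theorem exists_of_mem {n : ℕ} {E : Finset (Sym2 (Fin n))} {a b : Fin n}
    (hE : E ∈ cycleFamily n 4) (h : s(a, b) ∈ E) :
    ∃ c d, Dist4 a b c d ∧ E = cyc4 a b c d := by
  obtain ⟨p, q, r, t, hd, rfl⟩ := (mem_cycleFamily_four E).1 hE
  unfold Dist4 at *
  simp only [cyc4, Finset.mem_insert, Finset.mem_singleton, Sym2.eq_iff] at h
  rcases h with (⟨rfl, rfl⟩ | ⟨rfl, rfl⟩) | (⟨rfl, rfl⟩ | ⟨rfl, rfl⟩) |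
    (⟨rfl, rfl⟩ | ⟨rfl, rfl⟩) | (⟨rfl, rfl⟩ | ⟨rfl, rfl⟩)
  · exact ⟨r, t, by grind, rfl⟩
  · exact ⟨t, r, by grind, by ext x; simp only [cyc4, Finset.mem_insert, Finset.mem_singleton, Sym2.eq_swap]; grind [Sym2.eq_swap]⟩
  · exact ⟨t, p, by grind, by ext x; simp only [cyc4, Finset.mem_insert, Finset.mem_singleton]; grind [Sym2.eq_swap]⟩
  · exact ⟨p, t, by grind, by ext x; simp only [cyc4, Finset.mem_insert, Finset.mem_singleton]; grind [Sym2.eq_swap]⟩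
  · exact ⟨p, q, by grind, by ext x; simp only [cyc4, Finset.mem_insert, Finset.mem_singleton]; grind [Sym2.eq_swap]⟩
  · exact ⟨q, p, by grind, by ext x; simp only [cyc4, Finset.mem_insert, Finset.mem_singleton]; grind [Sym2.eq_swap]⟩
  · exact ⟨q, r, by grind, by ext x; simp only [cyc4, Finset.mem_insert, Finset.mem_singleton]; grind [Sym2.eq_swap]⟩
  · exact ⟨r, q, by grind, by ext x; simp only [cyc4, Finset.mem_insert, Finset.mem_singleton]; grind [Sym2.eq_swap]⟩

theorem ncard_famAt {n : ℕ} {a b : Fin n} (hab : a ≠ b) :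
    (famAt (cycleFamily n 4) s(a, b)).ncard = (n - 2) * (n - 2) - (n - 2) := by
  have himg : famAt (cycleFamily n 4) s(a, b) =
      (fun p : Fin n × Fin n => cyc4 a b p.1 p.2) ''
        ((({a, b} : Finset (Fin n))ᶜ.offDiag : Finset (Fin n × Fin n)) : Set (Fin n × Fin n)) := by
    ext E
    constructor
    · rintro ⟨hE, h⟩
      obtain ⟨c, d, hd, rfl⟩ := exists_of_mem hE h
      refine ⟨(c, d), ?_, rfl⟩
      unfold Dist4 at hd
      simp
      grind
    · rintro ⟨⟨c, d⟩, h, rfl⟩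
      simp at h
      refine ⟨(mem_cycleFamily_four _).2 ⟨a, b, c, d, ?_, rfl⟩, by simp [cyc4]⟩
      unfold Dist4
      grind
  rw [himg, Set.ncard_image_of_injOn, Set.ncard_coe_finset, Finset.offDiag_card,
    Finset.card_compl, Finset.card_pair hab, Fintype.card_fin]
  rintro ⟨c, d⟩ h ⟨c₁, d₁⟩ h₁ heq
  simp at h h₁ heq
  have h1 : s(b, c) ∈ cyc4 a b c₁ d₁ := by rw [← heq]; simp [cyc4]
  have h2 : s(d, a) ∈ cyc4 a b c₁ d₁ := by rw [← heq]; simp [cyc4]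
  simp only [cyc4, Finset.mem_insert, Finset.mem_singleton, Sym2.eq_iff] at h1 h2
  simp
  grind

theorem ncard_two {n : ℕ} (hn : 2 ≤ n) {e f : Sym2 (Fin n)} (hef : e ≠ f) :
    {E ∈ cycleFamily n 4 | e ∈ E ∧ f ∈ E}.ncard ≤ n := by
  classical
  induction e using Sym2.inductionOn with | _ a b =>
  induction f using Sym2.inductionOn with | _ x y =>
  by_cases hadj : ∃ a₁ b₁ c₁, s(a, b) = s(a₁, b₁) ∧ s(x, y) = s(b₁, c₁)
  · obtain ⟨a₁, b₁, c₁, h1, h2⟩ := hadj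
    rw [h1, h2] at hef ⊢
    have hsub : {E ∈ cycleFamily n 4 | s(a₁, b₁) ∈ E ∧ s(b₁, c₁) ∈ E} ⊆
        ((Finset.univ.image (fun d => cyc4 a₁ b₁ c₁ d) : Finset _) : Set _) := by
      rintro E ⟨hE, h3, h4⟩
      obtain ⟨c, d, hd, rfl⟩ := exists_of_mem hE h3
      unfold Dist4 at hd
      simp only [cyc4, Finset.mem_insert, Finset.mem_singleton, Sym2.eq_iff] at h4
      have : c = c₁ := by
        rw [Ne, Sym2.eq_iff] at hef
        grind
      subst this
      simp
    refine (Set.ncard_le_ncard hsub (Finset.finite_toSet _)).trans ?_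
    rw [Set.ncard_coe_finset]
    exact Finset.card_image_le.trans (by simp)
  · have hsub : {E ∈ cycleFamily n 4 | s(a, b) ∈ E ∧ s(x, y) ∈ E} ⊆
        (({cyc4 a b x y, cyc4 a b y x} : Finset (Finset (Sym2 (Fin n)))) : Set _) := by
      rintro E ⟨hE, h3, h4⟩
      obtain ⟨c, d, hd, rfl⟩ := exists_of_mem hE h3
      simp only [cyc4, Finset.mem_insert, Finset.mem_singleton] at h4
      rcases h4 with h4 | h4 | h4 | h4
      · exact absurd h4.symm hef
      · exact absurd ⟨a, b, c, rfl, h4⟩ hadj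
      · rcases Sym2.eq_iff.1 h4 with ⟨rfl, rfl⟩ | ⟨rfl, rfl⟩ <;> simp
      · exact absurd ⟨b, a, d, Sym2.eq_swap, h4.trans Sym2.eq_swap⟩ hadj
    refine (Set.ncard_le_ncard hsub (Finset.finite_toSet _)).trans ?_
    rw [Set.ncard_coe_finset]
    exact Finset.card_le_two.trans hn

theorem card_le_four {n : ℕ} {E : Finset (Sym2 (Fin n))} (hE : E ∈ cycleFamily n 4) :
    E.card ≤ 4 := by
  obtain ⟨a, b, c, d, -, rfl⟩ := (mem_cycleFamily_four E).1 hE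
  exact Finset.card_le_four

/-- An intersecting family with no common edge is small. -/
theorem ncard_nontrivial {n : ℕ} (hn : 2 ≤ n) (ℬ : Set (Finset (Sym2 (Fin n))))
    (hsub : ℬ ⊆ cycleFamily n 4) (hint : IsIntersectingFamily ℬ)
    (hnt : ∀ e, ∃ B ∈ ℬ, e ∉ B) : ℬ.ncard ≤ 4 * (4 * n) := by
  classical
  obtain ⟨A, hA, -⟩ := hnt s(⟨0, by omega⟩, ⟨0, by omega⟩)
  choose B hB heB using hnt
  have key : ∀ e, {E ∈ ℬ | e ∈ E}.ncard ≤ 4 * n := by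
    intro e
    have hs : {E ∈ ℬ | e ∈ E} ⊆ ⋃ f ∈ B e, {E ∈ cycleFamily n 4 | e ∈ E ∧ f ∈ E} := by
      rintro E ⟨hE, he⟩
      obtain ⟨f, hf1, hf2⟩ := hint E hE (B e) (hB e)
      simp only [Set.mem_iUnion]
      exact ⟨f, hf2, hsub hE, he, hf1⟩
    calc _ ≤ _ := Set.ncard_le_ncard hs (Set.toFinite _)
      _ ≤ ∑ f ∈ B e, {E ∈ cycleFamily n 4 | e ∈ E ∧ f ∈ E}.ncard :=
        Finset.set_ncard_biUnion_le _ _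
      _ ≤ (B e).card • n := Finset.sum_le_card_nsmul _ _ _ fun f hf =>
        ncard_two hn (fun h => heB e (h ▸ hf))
      _ ≤ 4 * n := Nat.mul_le_mul_right _ (card_le_four (hsub (hB e)))
  have hs : ℬ ⊆ ⋃ e ∈ A, {E ∈ ℬ | e ∈ E} := by
    intro E hE
    obtain ⟨f, hf1, hf2⟩ := hint E hE A hA
    simp only [Set.mem_iUnion]
    exact ⟨f, hf2, hE, hf1⟩
  calc _ ≤ _ := Set.ncard_le_ncard hs (Set.toFinite _)
    _ ≤ ∑ e ∈ A, {E ∈ ℬ | e ∈ E}.ncard := Finset.set_ncard_biUnion_le _ _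
    _ ≤ A.card • (4 * n) := Finset.sum_le_card_nsmul _ _ _ fun f hf => key f
    _ ≤ 4 * (4 * n) := Nat.mul_le_mul_right _ (card_le_four (hsub hA))

theorem ncard_famAt_edge {n : ℕ} {e : Sym2 (Fin n)} (he : e ∈ (⊤ : SimpleGraph (Fin n)).edgeSet) :
    (famAt (cycleFamily n 4) e).ncard = (n - 2) * (n - 2) - (n - 2) := by
  induction e using Sym2.inductionOn with | _ a b =>
  exact ncard_famAt (by simpa using he)

theorem edge_of_mem {n : ℕ} {E : Finset (Sym2 (Fin n))} (hE : E ∈ cycleFamily n 4)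
    {e : Sym2 (Fin n)} (he : e ∈ E) : e ∈ (⊤ : SimpleGraph (Fin n)).edgeSet := by
  obtain ⟨v, w, -, -, rfl⟩ := hE
  exact w.edges_subset_edgeSet (by simpa using he)

theorem small_lt {n : ℕ} (hn : 24 ≤ n) : 4 * (4 * n) < (n - 2) * (n - 2) - (n - 2) := by
  obtain ⟨m, rfl⟩ := Nat.exists_eq_add_of_le hn
  have : 24 + m - 2 = 22 + m := by omega
  rw [this]
  apply Nat.lt_sub_of_add_lt
  nlinarith

/-- Dichotomy for intersecting families of 4-cycles. -/
theorem dichotomy {n : ℕ} (hn : 24 ≤ n) (ℬ : Set (Finset (Sym2 (Fin n))))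
    (hsub : ℬ ⊆ cycleFamily n 4) (hint : IsIntersectingFamily ℬ) :
    ℬ.ncard < (n - 2) * (n - 2) - (n - 2) ∨
      ∃ e ∈ (⊤ : SimpleGraph (Fin n)).edgeSet, ℬ ⊆ famAt (cycleFamily n 4) e := by
  by_cases hnt : ∀ e, ∃ B ∈ ℬ, e ∉ B
  · exact .inl ((ncard_nontrivial (by omega) ℬ hsub hint hnt).trans_lt (small_lt hn))
  · push Not at hnt
    obtain ⟨e, he⟩ := hnt
    rcases ℬ.eq_empty_or_nonempty with rfl | ⟨A, hA⟩
    · left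
      rw [Set.ncard_empty]
      exact (Nat.zero_le _).trans_lt (small_lt hn)
    · exact .inr ⟨e, edge_of_mem (hsub hA) (he A hA), fun E hE => ⟨hsub hE, he E hE⟩⟩

/-- For every `n ≥ 24` the family of all 4-cycles of `K_n` is an EKR family and moreover a
strong EKR family. -/
theorem fourCycles_EKR (n : ℕ) (hn : 24 ≤ n) :
    IsEKRFamily (⊤ : SimpleGraph (Fin n)).edgeSet (cycleFamily n 4) ∧
    IsStrongEKRFamily (⊤ : SimpleGraph (Fin n)).edgeSet (cycleFamily n 4) := by
  have h1 : IsEKRFamily (⊤ : SimpleGraph (Fin n)).edgeSet (cycleFamily n 4) := by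
    intro x hx ℬ hsub hint
    rw [ncard_famAt_edge hx]
    rcases dichotomy hn ℬ hsub hint with h | ⟨e, he, h⟩
    · exact h.le
    · rw [← ncard_famAt_edge he]
      exact Set.ncard_le_ncard h (Set.toFinite _)
  refine ⟨h1, h1, ?_⟩
  intro ℬ hsub hint hmax
  have hstar : ∀ e ∈ (⊤ : SimpleGraph (Fin n)).edgeSet,
      (famAt (cycleFamily n 4) e).ncard ≤ ℬ.ncard := fun e _ =>
    hmax _ (fun E hE => hE.1) (fun A hA B hB => ⟨e, hA.2, hB.2⟩)
  rcases dichotomy hn ℬ hsub hint with h | ⟨e, he, h⟩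
  · have he : s((⟨0, by omega⟩ : Fin n), ⟨1, by omega⟩) ∈ (⊤ : SimpleGraph (Fin n)).edgeSet := by
      simp
    have := hstar _ he
    rw [ncard_famAt_edge he] at this
    omega
  · exact ⟨e, he, Set.eq_of_subset_of_ncard_le h (hstar e he) (Set.toFinite _)⟩
end

section
/- Let k ≥ 5 be an integer. For every integer n ≥ 3k − 3, the family ℱ_n(C_k) of all k-cycles in the complete graph K_n is an EKR family, and for every integer n ≥ 3k − 2 it is a strong EKR family. -/
section CycleEncoding

open SimpleGraph

/-- Membership in the edge list of a walk, in terms of `getVert`. -/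
lemma mem_edges_iff_getVert {V : Type*} {G : SimpleGraph V} {u v : V} (w : G.Walk u v)
    (e : Sym2 V) : e ∈ w.edges ↔ ∃ i < w.length, e = s(w.getVert i, w.getVert (i + 1)) := by
  induction w with
  | nil => simp
  | cons h p ih =>
    rw [Walk.edges_cons, List.mem_cons, ih]
    constructor
    · rintro (rfl | ⟨i, hi, rfl⟩)
      · exact ⟨0, by simp, by simp⟩
      · exact ⟨i + 1, by simpa using hi, by simp⟩
    · rintro ⟨i, hi, rfl⟩
      cases i with
      | zero => left; simp
      | succ i => right; exact ⟨i, by simpa using hi, by simp⟩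

/-- A walk along a sequence of vertices. -/
def walkOf {V : Type*} {G : SimpleGraph V} :
    (m : ℕ) → (f : ℕ → V) → (∀ i < m, G.Adj (f i) (f (i + 1))) → G.Walk (f 0) (f m)
  | 0, _, _ => Walk.nil
  | m + 1, f, h => Walk.cons (h 0 (Nat.succ_pos m))
      (walkOf m (fun i => f (i + 1)) (fun i hi => h (i + 1) (Nat.succ_lt_succ hi)))

lemma walkOf_length {V : Type*} {G : SimpleGraph V} (m : ℕ) (f : ℕ → V)
    (h : ∀ i < m, G.Adj (f i) (f (i + 1))) : (walkOf m f h).length = m := by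
  induction m generalizing f with
  | zero => rfl
  | succ m ih => simp [walkOf, ih]

lemma walkOf_getVert {V : Type*} {G : SimpleGraph V} (m : ℕ) (f : ℕ → V)
    (h : ∀ i < m, G.Adj (f i) (f (i + 1))) (i : ℕ) (hi : i ≤ m) :
    (walkOf m f h).getVert i = f i := by
  induction m generalizing f i with
  | zero => obtain rfl : i = 0 := by omega
            rfl
  | succ m ih =>
    cases i with
    | zero => simp
    | succ i =>
      simp only [walkOf, Walk.getVert_cons_succ]
      exact ih _ _ i (by omega)

/-- The edge set of the closed sequence `φ`. -/
def cyc {V : Type*} [DecidableEq V] {k : ℕ} [NeZero k] (φ : ZMod k → V) : Finset (Sym2 V) :=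
  Finset.univ.image (fun i : ZMod k => s(φ i, φ (i + 1)))

lemma mem_cyc {V : Type*} [DecidableEq V] {k : ℕ} [NeZero k] (φ : ZMod k → V) (e : Sym2 V) :
    e ∈ cyc φ ↔ ∃ i, s(φ i, φ (i + 1)) = e := by
  simp [cyc]

lemma cyc_mem_cycleFamily {n k : ℕ} [NeZero k] (hk : 3 ≤ k) (φ : ZMod k → Fin n)
    (hφ : Function.Injective φ) : cyc φ ∈ cycleFamily n k := by
  have hcast : ∀ a b : ℕ, a < k → b < k → (a : ZMod k) = b → a = b := by
    intro a b ha hb h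
    rw [ZMod.natCast_eq_natCast_iff'] at h
    rwa [Nat.mod_eq_of_lt ha, Nat.mod_eq_of_lt hb] at h
  have hadj : ∀ i < k, (⊤ : SimpleGraph (Fin n)).Adj (φ (i : ℕ)) (φ ((i + 1 : ℕ))) := by
    intro i _
    rw [top_adj]
    intro h
    have h1 := hφ h
    push_cast at h1
    have h2 : ((0 : ℕ) : ZMod k) = ((1 : ℕ) : ZMod k) := by
      push_cast
      exact add_left_cancel (a := (i : ZMod k)) (by simpa using h1)
    have := hcast 0 1 (by omega) (by omega) h2
    omega
  let w := walkOf k (fun i : ℕ => φ (i : ZMod k)) hadj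
  have hl : w.length = k := walkOf_length _ _ _
  have hend : φ ((k : ℕ) : ZMod k) = φ ((0 : ℕ) : ZMod k) := by simp
  refine ⟨φ ((0 : ℕ) : ZMod k), w.copy rfl hend, ?_, by simpa using hl, ?_⟩
  · rw [Walk.isCycle_iff_isPath_tail_and_le_length]
    constructor
    · rw [← Walk.IsPath.getVert_injOn_iff]
      intro i hi j hj hij
      have htl : (w.copy rfl hend).tail.length + 1 = (w.copy rfl hend).length := by
        apply Walk.length_tail_add_one
        rw [Walk.not_nil_iff_lt_length]
        simp [hl]; omega
      have hlc : (w.copy rfl hend).length = k := by simpa using hl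
      simp only [Set.mem_ofPred_eq] at hi hj
      rw [Walk.getVert_tail, Walk.getVert_tail] at hij
      simp only [Walk.getVert_copy] at hij
      rw [walkOf_getVert _ _ _ _ (by omega), walkOf_getVert _ _ _ _ (by omega)] at hij
      have h1 := hφ hij
      push_cast at h1
      exact hcast i j (by omega) (by omega) (add_right_cancel h1)
    · simpa [hl] using hk
  · ext e
    rw [List.mem_toFinset, Walk.edges_copy, mem_edges_iff_getVert, mem_cyc, hl]
    constructor
    · rintro ⟨i, rfl⟩
      refine ⟨i.val, ZMod.val_lt i, ?_⟩
      rw [walkOf_getVert _ _ _ _ (ZMod.val_lt i).le, walkOf_getVert _ _ _ _ (ZMod.val_lt i)]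
      simp
    · rintro ⟨i, hi, rfl⟩
      refine ⟨i, ?_⟩
      rw [walkOf_getVert _ _ _ _ hi.le, walkOf_getVert _ _ _ _ hi]
      simp

lemma exists_of_mem_cycleFamily {n k : ℕ} [NeZero k] {E : Finset (Sym2 (Fin n))}
    (hE : E ∈ cycleFamily n k) : ∃ φ : ZMod k → Fin n, Function.Injective φ ∧ cyc φ = E := by
  obtain ⟨v, w, hw, hl, rfl⟩ := hE
  have hsucc : ∀ i : ZMod k, w.getVert (i + 1).val = w.getVert (i.val + 1) := by
    intro i
    rcases Nat.lt_or_ge (i.val + 1) k with h | h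
    · congr 1
      have : (i + 1) = ((i.val + 1 : ℕ) : ZMod k) := by simp
      rw [this, ZMod.val_cast_of_lt h]
    · have h1 : i.val + 1 = k := le_antisymm (ZMod.val_lt i) h
      have : (i + 1) = ((i.val + 1 : ℕ) : ZMod k) := by simp
      rw [this, h1]
      have : w.getVert k = v := by rw [← hl]; simp
      rw [this]; simp
  refine ⟨fun i => w.getVert i.val, ?_, ?_⟩
  · intro i j hij
    have := hw.getVert_injOn'
      (show i.val ∈ {i | i ≤ w.length - 1} by have := ZMod.val_lt i; simp; omega)
      (show j.val ∈ {i | i ≤ w.length - 1} by have := ZMod.val_lt j; simp; omega) hij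
    exact ZMod.val_injective k this
  · ext e
    rw [List.mem_toFinset, mem_edges_iff_getVert, mem_cyc]
    constructor
    · rintro ⟨i, rfl⟩
      exact ⟨i.val, by rw [hl]; exact ZMod.val_lt i, by rw [hsucc]⟩
    · rintro ⟨i, hi, rfl⟩
      refine ⟨(i : ZMod k), ?_⟩
      rw [hsucc, ZMod.val_cast_of_lt (by omega)]

/-- A cycle through the edge `uv` can be traversed starting with `u, v`. -/
lemma exists_rotation {V : Type*} [DecidableEq V] {k : ℕ} [NeZero k] (φ : ZMod k → V)
    (hφ : Function.Injective φ) (u v : V) (h : s(u, v) ∈ cyc φ) :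
    ∃ ψ : ZMod k → V, Function.Injective ψ ∧ cyc ψ = cyc φ ∧ ψ 0 = u ∧ ψ 1 = v := by
  rw [mem_cyc] at h
  obtain ⟨i, hi⟩ := h
  rw [Sym2.eq_iff] at hi
  rcases hi with ⟨h1, h2⟩ | ⟨h1, h2⟩
  · refine ⟨fun j => φ (i + j), fun a b hab => add_left_cancel (hφ hab), ?_, by simpa, by simpa⟩
    ext e
    rw [mem_cyc, mem_cyc]
    constructor
    · rintro ⟨j, rfl⟩
      exact ⟨i + j, by rw [add_assoc]⟩
    · rintro ⟨j, rfl⟩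
      refine ⟨j - i, ?_⟩
      have e1 : i + (j - i) = j := by ring
      have e2 : i + (j - i + 1) = j + 1 := by ring
      simp only [e1, e2]
  · refine ⟨fun j => φ (i + 1 - j), fun a b hab => sub_right_injective (hφ hab), ?_,
      by simpa, by simpa⟩
    ext e
    rw [mem_cyc, mem_cyc]
    constructor
    · rintro ⟨j, rfl⟩
      refine ⟨i - j, ?_⟩
      have e1 : i + 1 - j = i - j + 1 := by ring
      have e2 : i + 1 - (j + 1) = i - j := by ring
      simp only [e1, e2]
      exact Sym2.eq_swap
    · rintro ⟨j, rfl⟩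
      refine ⟨i - j, ?_⟩
      have e1 : i + 1 - (i - j) = j + 1 := by ring
      have e2 : i + 1 - (i - j + 1) = j := by ring
      simp only [e1, e2]
      exact Sym2.eq_swap

/-- A cycle is determined by its edge set and its first two vertices. -/
lemma cyc_inj {V : Type*} [DecidableEq V] {k : ℕ} [NeZero k] (hk : 3 ≤ k) (φ ψ : ZMod k → V)
    (hφ : Function.Injective φ) (hψ : Function.Injective ψ) (h0 : φ 0 = ψ 0) (h1 : φ 1 = ψ 1)
    (h : cyc φ = cyc ψ) : φ = ψ := by
  have h02 : ∀ i : ZMod k, i ≠ i + 1 + 1 := by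
    intro i hi
    have h2 : ((2 : ℕ) : ZMod k) = 0 := by
      push_cast
      apply add_left_cancel (a := i)
      rw [add_zero]
      nth_rewrite 2 [hi]
      ring
    rw [ZMod.natCast_eq_zero_iff] at h2
    have := Nat.le_of_dvd (by norm_num) h2
    omega
  have key : ∀ m : ℕ, φ m = ψ m ∧ φ ((m + 1 : ℕ)) = ψ ((m + 1 : ℕ)) := by
    intro m
    induction m with
    | zero => simpa using ⟨h0, h1⟩
    | succ m ih =>
      refine ⟨ih.2, ?_⟩
      obtain ⟨ha, hb⟩ := ih
      push_cast at ha hb ⊢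
      have hmem : s(φ (m + 1), φ (m + 1 + 1)) ∈ cyc ψ := by
        rw [← h, mem_cyc]; exact ⟨_, rfl⟩
      rw [mem_cyc] at hmem
      obtain ⟨j, hj⟩ := hmem
      rw [Sym2.eq_iff] at hj
      rcases hj with ⟨h3, h4⟩ | ⟨h3, h4⟩
      · rw [hb] at h3
        have := hψ h3
        rw [← h4, this]
      · rw [hb] at h4
        have := add_right_cancel (hψ h4)
        rw [this, ← ha] at h3
        exact absurd (hφ h3) (h02 _)
  funext i
  have := (key i.val).1
  simpa using this

end CycleEncoding

section Counting

open Classical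

/-- The injective maps agreeing with `g` on `A`. -/
noncomputable def exts {V : Type*} [Fintype V] {k : ℕ} [NeZero k] (A : Finset (ZMod k))
    (g : ZMod k → V) : Finset (ZMod k → V) :=
  Finset.univ.filter (fun φ => Function.Injective φ ∧ ∀ i ∈ A, φ i = g i)

lemma mem_exts {V : Type*} [Fintype V] {k : ℕ} [NeZero k] (A : Finset (ZMod k))
    (g φ : ZMod k → V) :
    φ ∈ exts A g ↔ Function.Injective φ ∧ ∀ i ∈ A, φ i = g i := by
  simp [exts]

lemma injOn_update {V : Type*} [DecidableEq V] {k : ℕ} [NeZero k] (A : Finset (ZMod k))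
    (g : ZMod k → V) (hg : Set.InjOn g A) (i : ZMod k) (hi : i ∉ A) (v : V)
    (hv : v ∉ A.image g) : Set.InjOn (Function.update g i v) (insert i A : Finset (ZMod k)) := by
  have h1 : ∀ a ∈ A, Function.update g i v a = g a := fun a ha =>
    Function.update_of_ne (by rintro rfl; exact hi ha) _ _
  intro a ha b hb hab
  simp only [Finset.coe_insert, Set.mem_insert_iff, Finset.mem_coe] at ha hb
  rcases ha with rfl | ha <;> rcases hb with rfl | hb
  · rfl
  · rw [Function.update_self, h1 b hb] at hab
    exact absurd (Finset.mem_image.2 ⟨b, hb, hab.symm⟩) hv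
  · rw [Function.update_self, h1 a ha] at hab
    exact absurd (Finset.mem_image.2 ⟨a, ha, hab⟩) hv
  · rw [h1 a ha, h1 b hb] at hab
    exact hg ha hb hab

lemma mem_exts_update {V : Type*} [Fintype V] {k : ℕ} [NeZero k] (A : Finset (ZMod k))
    (g φ : ZMod k → V) (i : ZMod k) (hi : i ∉ A) (v : V) :
    φ ∈ exts (insert i A) (Function.update g i v) ↔ φ ∈ exts A g ∧ φ i = v := by
  have h1 : ∀ a ∈ A, Function.update g i v a = g a := fun a ha =>
    Function.update_of_ne (by rintro rfl; exact hi ha) _ _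
  simp only [mem_exts, Finset.mem_insert, forall_eq_or_imp, Function.update_self]
  constructor
  · rintro ⟨h, h2, h3⟩
    exact ⟨⟨h, fun a ha => (h3 a ha).trans (h1 a ha)⟩, h2⟩
  · rintro ⟨⟨h, h3⟩, h2⟩
    exact ⟨h, h2, fun a ha => (h3 a ha).trans (h1 a ha).symm⟩

lemma exts_val_notMem {V : Type*} [DecidableEq V] [Fintype V] {k : ℕ} [NeZero k] (A : Finset (ZMod k))
    (g φ : ZMod k → V) (h : φ ∈ exts A g) (i : ZMod k) (hi : i ∉ A) : φ i ∉ A.image g := by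
  rw [mem_exts] at h
  intro hm
  obtain ⟨a, ha, hag⟩ := Finset.mem_image.1 hm
  rw [← h.2 a ha] at hag
  exact hi (h.1 hag ▸ ha)

lemma card_exts {V : Type*} [Fintype V] {k : ℕ} [NeZero k] (r : ℕ) :
    ∀ (A : Finset (ZMod k)) (g : ZMod k → V), Set.InjOn g A → A.card + r = k →
    (exts A g).card = (Fintype.card V - A.card).descFactorial r := by
  induction r with
  | zero =>
    intro A g hg hA
    have hAu : A = Finset.univ := by
      apply Finset.eq_univ_of_card
      rw [ZMod.card]; omega
    subst hAu
    have : exts Finset.univ g = {g} := by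
      ext φ
      rw [mem_exts, Finset.mem_singleton]
      constructor
      · rintro ⟨_, h⟩
        funext i
        exact h i (Finset.mem_univ i)
      · rintro rfl
        exact ⟨by simpa [Set.injOn_univ] using hg, fun _ _ => rfl⟩
    simp [this]
  | succ r ih =>
    intro A g hg hA
    have hne : ∃ i, i ∉ A := by
      by_contra h
      push Not at h
      have : A = Finset.univ := Finset.eq_univ_iff_forall.2 h
      rw [this, Finset.card_univ, ZMod.card] at hA
      omega
    obtain ⟨i, hi⟩ := hne
    have hun : exts A g = ((A.image g)ᶜ).biUnion
        (fun v => exts (insert i A) (Function.update g i v)) := by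
      ext φ
      simp only [Finset.mem_biUnion, Finset.mem_compl]
      constructor
      · intro h
        exact ⟨φ i, exts_val_notMem A g φ h i hi, (mem_exts_update A g φ i hi _).2 ⟨h, rfl⟩⟩
      · rintro ⟨v, _, h⟩
        exact ((mem_exts_update A g φ i hi _).1 h).1
    rw [hun, Finset.card_biUnion]
    · have hc : ∀ v ∈ (A.image g)ᶜ, (exts (insert i A) (Function.update g i v)).card
          = (Fintype.card V - (A.card + 1)).descFactorial r := by
        intro v hv
        rw [Finset.mem_compl] at hv
        rw [ih _ _ (injOn_update A g hg i hi v hv)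
          (by rw [Finset.card_insert_of_notMem hi]; omega), Finset.card_insert_of_notMem hi]
      rw [Finset.sum_congr rfl hc, Finset.sum_const, Finset.card_compl,
        Finset.card_image_of_injOn hg, smul_eq_mul]
      cases hm : Fintype.card V - A.card with
      | zero => simp
      | succ m =>
        rw [Nat.succ_descFactorial_succ]
        congr 2
        omega
    · intro a _ b _ hab
      rw [Function.onFun, Finset.disjoint_left]
      intro φ h1 h2
      exact hab (((mem_exts_update A g φ i hi _).1 h1).2.symm.trans
        ((mem_exts_update A g φ i hi _).1 h2).2)

/-- The injective maps agreeing with `g` on `A` whose cycle lies in the family `F`. -/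
noncomputable def cnt {V : Type*} [DecidableEq V] [Fintype V] {k : ℕ} [NeZero k]
    (F : Set (Finset (Sym2 V))) (A : Finset (ZMod k))
    (g : ZMod k → V) : Finset (ZMod k → V) :=
  (exts A g).filter (fun φ => cyc φ ∈ F)

lemma exists_boundary {k : ℕ} [NeZero k] (A : Finset (ZMod k)) (h0 : A.Nonempty)
    (h1 : A.card < k) : ∃ i ∈ A, i + 1 ∉ A := by
  by_contra h
  push Not at h
  obtain ⟨a, ha⟩ := h0
  have key : ∀ m : ℕ, a + m ∈ A := by
    intro m
    induction m with
    | zero => simpa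
    | succ m ih =>
      have := h _ ih
      push_cast
      rwa [← add_assoc]
  have : A = Finset.univ := by
    rw [Finset.eq_univ_iff_forall]
    intro i
    have := key (i - a).val
    simpa using this
  rw [this, Finset.card_univ, ZMod.card] at h1
  omega

lemma exists_boundary' {k : ℕ} [NeZero k] (A : Finset (ZMod k)) (h0 : A.Nonempty)
    (h1 : A.card < k) : ∃ i, i ∉ A ∧ i + 1 ∈ A := by
  have hc : Aᶜ.card = k - A.card := by rw [Finset.card_compl, ZMod.card]
  obtain ⟨i, hi, hi'⟩ := exists_boundary Aᶜ (by rw [← Finset.card_pos]; omega)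
    (by have := h0.card_pos; omega)
  exact ⟨i, by simpa using hi, by simpa using hi'⟩

end Counting

section Recursion

open Classical

/-- Every position of `A` has a neighbouring position in `A`. -/
def Good {k : ℕ} (A : Finset (ZMod k)) : Prop := ∀ i ∈ A, i + 1 ∈ A ∨ i - 1 ∈ A

/-- The bound to be proved for partial assignments of `a` positions. -/
def Bnd {V : Type*} [DecidableEq V] [Fintype V] (k : ℕ) [NeZero k] (F : Set (Finset (Sym2 V)))
    (W : ℕ → ℝ) (a : ℕ) : Prop :=
  ∀ (A : Finset (ZMod k)) (g : ZMod k → V), A.card = a → Good A → Set.InjOn g A →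
    ((cnt F A g).card : ℝ) ≤ ((Fintype.card V - a).descFactorial (k - a) : ℝ) * W a

/-- The members of `cnt F A g` which use the edge `c` at a position not inside `A`. -/
noncomputable def hit {V : Type*} [DecidableEq V] [Fintype V] {k : ℕ} [NeZero k]
    (F : Set (Finset (Sym2 V))) (A : Finset (ZMod k)) (g : ZMod k → V) (c : Sym2 V) :
    Finset (ZMod k → V) :=
  (cnt F A g).filter (fun φ => ∃ i, ¬(i ∈ A ∧ i + 1 ∈ A) ∧ s(φ i, φ (i + 1)) = c)

variable {V : Type*} [DecidableEq V] [Fintype V] {k : ℕ} [NeZero k]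

lemma mem_cnt (F : Set (Finset (Sym2 V))) (A : Finset (ZMod k)) (g φ : ZMod k → V) :
    φ ∈ cnt F A g ↔ φ ∈ exts A g ∧ cyc φ ∈ F := by
  simp [cnt]

lemma mem_hit (F : Set (Finset (Sym2 V))) (A : Finset (ZMod k)) (g φ : ZMod k → V) (c : Sym2 V) :
    φ ∈ hit F A g c ↔ φ ∈ cnt F A g ∧ ∃ i, ¬(i ∈ A ∧ i + 1 ∈ A) ∧ s(φ i, φ (i + 1)) = c := by
  simp [hit]

lemma mem_cnt_update (F : Set (Finset (Sym2 V))) (A : Finset (ZMod k)) (g φ : ZMod k → V)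
    (i : ZMod k) (hi : i ∉ A) (v : V) :
    φ ∈ cnt F (insert i A) (Function.update g i v) ↔ φ ∈ cnt F A g ∧ φ i = v := by
  rw [mem_cnt, mem_cnt, mem_exts_update A g φ i hi v]
  tauto

lemma mem_of_val_mem (F : Set (Finset (Sym2 V))) (A : Finset (ZMod k)) (g φ : ZMod k → V)
    (h : φ ∈ cnt F A g) (i : ZMod k) (hi : φ i ∈ A.image g) : i ∈ A := by
  by_contra hA
  exact exts_val_notMem A g φ ((mem_cnt F A g φ).1 h).1 i hA hi

lemma val_mem_of_mem (F : Set (Finset (Sym2 V))) (A : Finset (ZMod k)) (g φ : ZMod k → V)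
    (h : φ ∈ cnt F A g) (i : ZMod k) (hi : i ∈ A) : φ i ∈ A.image g := by
  rw [mem_cnt, mem_exts] at h
  rw [h.1.2 i hi]
  exact Finset.mem_image_of_mem _ hi

lemma hit_two (F : Set (Finset (Sym2 V))) (A : Finset (ZMod k)) (g : ZMod k → V) (x y : V)
    (hx : x ∈ A.image g) (hy : y ∈ A.image g) : hit F A g s(x, y) = ∅ := by
  rw [Finset.eq_empty_iff_forall_notMem]
  intro φ hφ
  rw [mem_hit] at hφ
  obtain ⟨h, i, hi, he⟩ := hφ
  apply hi
  rw [Sym2.eq_iff] at he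
  rcases he with ⟨h1, h2⟩ | ⟨h1, h2⟩
  · exact ⟨mem_of_val_mem F A g φ h _ (h1 ▸ hx), mem_of_val_mem F A g φ h _ (h2 ▸ hy)⟩
  · exact ⟨mem_of_val_mem F A g φ h _ (h1 ▸ hy), mem_of_val_mem F A g φ h _ (h2 ▸ hx)⟩

lemma hit_one (F : Set (Finset (Sym2 V))) (W : ℕ → ℝ) (hW : ∀ a, 0 ≤ W a)
    (A : Finset (ZMod k)) (g : ZMod k → V)
    (hA : Good A) (hg : Set.InjOn g A) (hB : Bnd k F W (A.card + 1)) (x y : V)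
    (hx : x ∈ A.image g) (hy : y ∉ A.image g) :
    ((hit F A g s(x, y)).card : ℝ) ≤
      ((Fintype.card V - (A.card + 1)).descFactorial (k - (A.card + 1)) : ℝ) * W (A.card + 1) := by
  obtain ⟨j, hj, rfl⟩ := Finset.mem_image.1 hx
  -- the only position which can carry `y`
  have main : ∃ j', (j' + 1 = j ∨ j' - 1 = j) ∧
      ∀ φ ∈ hit F A g s(g j, y), φ j' = y := by
    have key : ∀ φ ∈ hit F A g s(g j, y), φ ∈ cnt F A g ∧ (φ (j + 1) = y ∨ φ (j - 1) = y) := by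
      intro φ hφ
      rw [mem_hit] at hφ
      obtain ⟨h, i, hi, he⟩ := hφ
      refine ⟨h, ?_⟩
      have h' := h
      rw [mem_cnt, mem_exts] at h'
      rw [← h'.1.2 j hj, Sym2.eq_iff] at he
      rcases he with ⟨h1, h2⟩ | ⟨h1, h2⟩
      · left; rw [← h'.1.1 h1]; exact h2
      · right; rw [← h'.1.1 h2, add_sub_cancel_right]; exact h1
    rcases hA j hj with h | h
    · refine ⟨j - 1, Or.inl (by ring), fun φ hφ => ?_⟩
      obtain ⟨h1, h2 | h2⟩ := key φ hφ
      · exact absurd (h2 ▸ val_mem_of_mem F A g φ h1 _ h) hy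
      · exact h2
    · refine ⟨j + 1, Or.inr (by ring), fun φ hφ => ?_⟩
      obtain ⟨h1, h2 | h2⟩ := key φ hφ
      · exact h2
      · exact absurd (h2 ▸ val_mem_of_mem F A g φ h1 _ h) hy
  obtain ⟨j', hjj, hφ⟩ := main
  by_cases hj' : j' ∈ A
  · have : hit F A g s(g j, y) = ∅ := by
      rw [Finset.eq_empty_iff_forall_notMem]
      intro φ h
      have h1 := hφ φ h
      rw [mem_hit] at h
      exact hy (h1 ▸ val_mem_of_mem F A g φ h.1 _ hj')
    rw [this, Finset.card_empty, Nat.cast_zero]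
    exact mul_nonneg (Nat.cast_nonneg _) (hW _)
  · have hsub : hit F A g s(g j, y) ⊆ cnt F (insert j' A) (Function.update g j' y) := by
      intro φ h
      rw [mem_cnt_update F A g φ j' hj']
      refine ⟨?_, hφ φ h⟩
      rw [mem_hit] at h
      exact h.1
    refine le_trans (by exact_mod_cast Finset.card_le_card hsub) (hB _ _ ?_ ?_ ?_)
    · exact Finset.card_insert_of_notMem hj'
    · intro i hi
      rw [Finset.mem_insert] at hi
      rcases hi with rfl | hi
      · rcases hjj with h | h
        · left; rw [h]; exact Finset.mem_insert_of_mem hj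
        · right; rw [h]; exact Finset.mem_insert_of_mem hj
      · exact (hA i hi).imp Finset.mem_insert_of_mem Finset.mem_insert_of_mem
    · exact injOn_update A g hg j' hj' y hy

lemma hit_zero_aux (hk : 2 ≤ k) (F : Set (Finset (Sym2 V))) (W : ℕ → ℝ)
    (A : Finset (ZMod k)) (g : ZMod k → V)
    (hA : Good A) (hg : Set.InjOn g A) (hB : Bnd k F W (A.card + 2)) (x y : V)
    (hx : x ∉ A.image g) (hy : y ∉ A.image g) (hxy : x ≠ y) (i : ZMod k) (hi : i ∉ A)
    (hi' : i + 1 ∉ A) :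
    (((cnt F A g).filter (fun φ => φ i = x ∧ φ (i + 1) = y)).card : ℝ) ≤
      ((Fintype.card V - (A.card + 2)).descFactorial (k - (A.card + 2)) : ℝ) * W (A.card + 2) := by
  have hne : i + 1 ≠ i := by
    intro h
    have h1 : ((1 : ℕ) : ZMod k) = 0 := by simpa using h
    rw [ZMod.natCast_eq_zero_iff] at h1
    have := Nat.le_of_dvd (by norm_num) h1
    omega
  have hi2 : i + 1 ∉ insert i A := by
    rw [Finset.mem_insert]; tauto
  have himg : (insert i A).image (Function.update g i x) = insert x (A.image g) := by
    rw [Finset.image_insert, Function.update_self]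
    congr 1
    apply Finset.image_congr
    intro a ha
    exact Function.update_of_ne (by rintro rfl; exact hi ha) _ _
  have hsub : (cnt F A g).filter (fun φ => φ i = x ∧ φ (i + 1) = y) ⊆
      cnt F (insert (i + 1) (insert i A))
        (Function.update (Function.update g i x) (i + 1) y) := by
    intro φ h
    rw [Finset.mem_filter] at h
    rw [mem_cnt_update F _ _ φ _ hi2, mem_cnt_update F A g φ i hi]
    tauto
  refine le_trans (by exact_mod_cast Finset.card_le_card hsub) (hB _ _ ?_ ?_ ?_)
  · rw [Finset.card_insert_of_notMem hi2, Finset.card_insert_of_notMem hi]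
  · intro j hj
    rw [Finset.mem_insert, Finset.mem_insert] at hj
    rcases hj with rfl | rfl | hj
    · right; simp
    · left; simp
    · exact (hA j hj).imp (fun h => Finset.mem_insert_of_mem (Finset.mem_insert_of_mem h))
        (fun h => Finset.mem_insert_of_mem (Finset.mem_insert_of_mem h))
  · apply injOn_update _ _ (injOn_update A g hg i hi x hx) _ hi2
    rw [himg, Finset.mem_insert]
    push Not
    exact ⟨hxy.symm, hy⟩

lemma hit_zero (hk : 2 ≤ k) (F : Set (Finset (Sym2 V))) (W : ℕ → ℝ) (hW : ∀ a, 0 ≤ W a)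
    (A : Finset (ZMod k)) (g : ZMod k → V) (hA0 : A.Nonempty) (hA1 : A.card < k)
    (hA : Good A) (hg : Set.InjOn g A) (hB : A.card + 2 ≤ k → Bnd k F W (A.card + 2)) (x y : V)
    (hx : x ∉ A.image g) (hy : y ∉ A.image g) :
    ((hit F A g s(x, y)).card : ℝ) ≤ 2 * ((k : ℝ) - A.card - 1) *
      (((Fintype.card V - (A.card + 2)).descFactorial (k - (A.card + 2)) : ℝ)
        * W (A.card + 2)) := by
  set B := ((Fintype.card V - (A.card + 2)).descFactorial (k - (A.card + 2)) : ℝ)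
        * W (A.card + 2) with hBdef
  have hB0 : 0 ≤ B := mul_nonneg (Nat.cast_nonneg _) (hW _)
  set I := Finset.univ.filter (fun i : ZMod k => i ∉ A ∧ i + 1 ∉ A) with hI
  have hIcard : I.card + A.card + 1 ≤ k := by
    obtain ⟨i0, h0, h1⟩ := exists_boundary' A hA0 hA1
    have hs : I ⊆ (Aᶜ).erase i0 := by
      intro i hi
      rw [hI, Finset.mem_filter] at hi
      rw [Finset.mem_erase, Finset.mem_compl]
      exact ⟨by rintro rfl; exact hi.2.2 h1, hi.2.1⟩
    have := Finset.card_le_card hs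
    rw [Finset.card_erase_of_mem (by simpa using h0), Finset.card_compl, ZMod.card] at this
    omega
  have hsub : hit F A g s(x, y) ⊆ I.biUnion (fun i =>
      (cnt F A g).filter (fun φ => φ i = x ∧ φ (i + 1) = y) ∪
      (cnt F A g).filter (fun φ => φ i = y ∧ φ (i + 1) = x)) := by
    intro φ hφ
    rw [mem_hit] at hφ
    obtain ⟨h, i, hi, he⟩ := hφ
    rw [Sym2.eq_iff] at he
    rw [Finset.mem_biUnion]
    refine ⟨i, ?_, ?_⟩
    · rw [hI, Finset.mem_filter]
      refine ⟨Finset.mem_univ _, fun hm => ?_, fun hm => ?_⟩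
      · have := val_mem_of_mem F A g φ h _ hm
        rcases he with ⟨h1, h2⟩ | ⟨h1, h2⟩ <;> rw [h1] at this
        exacts [hx this, hy this]
      · have := val_mem_of_mem F A g φ h _ hm
        rcases he with ⟨h1, h2⟩ | ⟨h1, h2⟩ <;> rw [h2] at this
        exacts [hy this, hx this]
    · simp only [Finset.mem_union, Finset.mem_filter]
      tauto
  have hcard : ∀ i ∈ I, (((cnt F A g).filter (fun φ => φ i = x ∧ φ (i + 1) = y) ∪
      (cnt F A g).filter (fun φ => φ i = y ∧ φ (i + 1) = x)).card : ℝ) ≤ 2 * B := by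
    intro i hi
    have hIpos : 0 < I.card := Finset.card_pos.2 ⟨i, hi⟩
    have hB' := hB (by omega)
    rw [hI, Finset.mem_filter] at hi
    by_cases hxy : x = y
    · have hemp : ∀ φ ∈ cnt F A g, ¬ (φ i = x ∧ φ (i + 1) = x) := by
        intro φ hφ h
        rw [mem_cnt, mem_exts] at hφ
        have h2 := hφ.1.1 (h.1.trans h.2.symm)
        have h1 : ((1 : ℕ) : ZMod k) = 0 := by simpa using h2
        rw [ZMod.natCast_eq_zero_iff] at h1
        have := Nat.le_of_dvd (by norm_num) h1
        omega
      subst hxy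
      rw [Finset.union_self, Finset.filter_eq_empty_iff.2 (fun φ hφ => hemp φ hφ)]
      simp only [Finset.card_empty, Nat.cast_zero]
      linarith
    · have h1 := hit_zero_aux hk F W A g hA hg hB' x y hx hy hxy i hi.2.1 hi.2.2
      have h2 := hit_zero_aux hk F W A g hA hg hB' y x hy hx (Ne.symm hxy) i hi.2.1 hi.2.2
      have h3 : (((cnt F A g).filter (fun φ => φ i = x ∧ φ (i + 1) = y) ∪
        (cnt F A g).filter (fun φ => φ i = y ∧ φ (i + 1) = x)).card : ℝ) ≤
        ((cnt F A g).filter (fun φ => φ i = x ∧ φ (i + 1) = y)).card +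
        ((cnt F A g).filter (fun φ => φ i = y ∧ φ (i + 1) = x)).card := by
        exact_mod_cast Finset.card_union_le _ _
      linarith
  have h1 : ((hit F A g s(x, y)).card : ℝ) ≤ ∑ i ∈ I, 2 * B := by
    refine le_trans (Nat.cast_le.2 ((Finset.card_le_card hsub).trans Finset.card_biUnion_le)) ?_
    push_cast
    exact Finset.sum_le_sum hcard
  rw [Finset.sum_const, nsmul_eq_mul] at h1
  have h2 : (I.card : ℝ) ≤ (k : ℝ) - A.card - 1 := by
    have : ((I.card + A.card + 1 : ℕ) : ℝ) ≤ k := by exact_mod_cast hIcard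
    push_cast at this
    linarith
  nlinarith

/-- The recursion. -/
theorem bnd_all (hk : 2 ≤ k) (hn : k ≤ Fintype.card V) (F : Set (Finset (Sym2 V)))
    (hF : IsIntersectingFamily F) (hFc : ∀ C ∈ F, C.card ≤ k) (m : ℕ) (hm : m < k)
    (hcov : ∀ T : Finset (Sym2 V), T.card < m → ∃ C ∈ F, ∀ e ∈ C, e ∉ T)
    (W : ℕ → ℝ) (hW : ∀ a, 0 ≤ W a) (hW1 : ∀ a, m < a → 1 ≤ W a)
    (h1 : ∀ a, 2 ≤ a → a ≤ m → (k : ℝ) * W (a + 1) ≤ ((Fintype.card V : ℝ) - a) * W a)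
    (h2 : ∀ a, 2 ≤ a → a ≤ m → (k : ℝ) * (2 * ((k : ℝ) - a - 1)) * W (a + 2) ≤
      ((Fintype.card V : ℝ) - a) * ((Fintype.card V : ℝ) - a - 1) * W a) :
    ∀ r a, a + r = k → 2 ≤ a → Bnd k F W a := by
  intro r
  induction r using Nat.strong_induction_on with
  | _ r ih =>
  intro a har ha2 A g hAa hA hg
  subst hAa
  rcases Nat.lt_or_ge m A.card with hma | hma
  · have hle : ((cnt F A g).card : ℝ) ≤
        ((Fintype.card V - A.card).descFactorial (k - A.card) : ℝ) := by
      rw [← card_exts (k - A.card) A g hg (by omega)]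
      exact_mod_cast Finset.card_le_card (Finset.filter_subset _ _)
    refine hle.trans ?_
    exact le_mul_of_one_le_right (Nat.cast_nonneg _) (hW1 _ hma)
  have hA0 : A.Nonempty := by rw [← Finset.card_pos]; omega
  have hA1 : A.card < k := by omega
  set D0 : ℝ := ((Fintype.card V - A.card).descFactorial (k - A.card) : ℝ) with hD0
  -- the cycle avoiding the determined edges
  obtain ⟨C, hC, hCT⟩ := hcov
    ((A.filter (fun i => i + 1 ∈ A)).image (fun i => s(g i, g (i + 1)))) (by
      obtain ⟨i0, h0, h0'⟩ := exists_boundary A hA0 hA1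
      have hs : A.filter (fun i => i + 1 ∈ A) ⊆ A.erase i0 := by
        intro i hi
        rw [Finset.mem_filter] at hi
        rw [Finset.mem_erase]
        exact ⟨by rintro rfl; exact h0' hi.2, hi.1⟩
      have h3 := Finset.card_le_card hs
      rw [Finset.card_erase_of_mem h0] at h3
      have h4 := Finset.card_image_le (s := A.filter (fun i => i + 1 ∈ A))
        (f := fun i => s(g i, g (i + 1)))
      omega)
  have hsub : cnt F A g ⊆ C.biUnion (fun c => hit F A g c) := by
    intro φ hφ
    have hφ' := hφ
    rw [mem_cnt, mem_exts] at hφ'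
    obtain ⟨e, he, heC⟩ := hF _ hφ'.2 _ hC
    rw [mem_cyc] at he
    obtain ⟨i, rfl⟩ := he
    rw [Finset.mem_biUnion]
    refine ⟨_, heC, ?_⟩
    rw [mem_hit]
    refine ⟨hφ, i, ?_, rfl⟩
    rintro ⟨hi, hi'⟩
    apply hCT _ heC
    rw [Finset.mem_image]
    exact ⟨i, by rw [Finset.mem_filter]; exact ⟨hi, hi'⟩, by
      rw [hφ'.1.2 i hi, hφ'.1.2 _ hi']⟩
  have hD1 : D0 = ((Fintype.card V : ℝ) - A.card) *
      ((Fintype.card V - (A.card + 1)).descFactorial (k - (A.card + 1)) : ℝ) := by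
    obtain ⟨p, hp⟩ : ∃ p, Fintype.card V - A.card = p + 1 :=
      ⟨Fintype.card V - A.card - 1, by omega⟩
    obtain ⟨q, hq⟩ : ∃ q, k - A.card = q + 1 := ⟨k - A.card - 1, by omega⟩
    have e1 : Fintype.card V - (A.card + 1) = p := by omega
    have e2 : k - (A.card + 1) = q := by omega
    have e3 : (Fintype.card V : ℝ) - A.card = ((p + 1 : ℕ) : ℝ) := by
      rw [← hp, Nat.cast_sub (by omega)]
    rw [hD0, hp, hq, e1, e2, e3, Nat.succ_descFactorial_succ]
    push_cast
    ring
  have hD2 : A.card + 2 ≤ k → D0 = ((Fintype.card V : ℝ) - A.card) *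
      ((Fintype.card V : ℝ) - A.card - 1) *
      ((Fintype.card V - (A.card + 2)).descFactorial (k - (A.card + 2)) : ℝ) := by
    intro h
    rw [hD1]
    obtain ⟨p, hp⟩ : ∃ p, Fintype.card V - (A.card + 1) = p + 1 :=
      ⟨Fintype.card V - A.card - 2, by omega⟩
    obtain ⟨q, hq⟩ : ∃ q, k - (A.card + 1) = q + 1 := ⟨k - A.card - 2, by omega⟩
    have e1 : Fintype.card V - (A.card + 2) = p := by omega
    have e2 : k - (A.card + 2) = q := by omega
    have e3 : (Fintype.card V : ℝ) - A.card - 1 = ((p + 1 : ℕ) : ℝ) := by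
      rw [← hp, Nat.cast_sub (by omega)]
      push_cast
      ring
    rw [hp, hq, e1, e2, e3, Nat.succ_descFactorial_succ]
    push_cast
    ring
  have hD0n : 0 ≤ D0 := Nat.cast_nonneg _
  have hedge : ∀ c ∈ C, (k : ℝ) * ((hit F A g c).card : ℝ) ≤ D0 * W A.card := by
    intro c _
    have hone : ∀ x y, x ∈ A.image g → y ∉ A.image g →
        (k : ℝ) * ((hit F A g s(x, y)).card : ℝ) ≤ D0 * W A.card := by
      intro x y hx hy
      have h3 := hit_one F W hW A g hA hg
        (ih (r - 1) (by omega) (A.card + 1) (by omega) (by omega)) x y hx hy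
      have h4 := h1 A.card ha2 hma
      rw [hD1]
      set D1 : ℝ := ((Fintype.card V - (A.card + 1)).descFactorial (k - (A.card + 1)) : ℝ)
      have hD1n : 0 ≤ D1 := Nat.cast_nonneg _
      calc (k : ℝ) * ((hit F A g s(x, y)).card : ℝ) ≤ k * (D1 * W (A.card + 1)) :=
            mul_le_mul_of_nonneg_left h3 (Nat.cast_nonneg _)
        _ = D1 * (k * W (A.card + 1)) := by ring
        _ ≤ D1 * (((Fintype.card V : ℝ) - A.card) * W A.card) :=
            mul_le_mul_of_nonneg_left h4 hD1n
        _ = _ := by ring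
    induction c using Sym2.ind with
    | _ x y =>
    by_cases hx : x ∈ A.image g
    · by_cases hy : y ∈ A.image g
      · rw [hit_two F A g x y hx hy]
        simpa using mul_nonneg hD0n (hW _)
      · exact hone x y hx hy
    · by_cases hy : y ∈ A.image g
      · rw [Sym2.eq_swap]
        exact hone y x hy hx
      · have h3 := hit_zero hk F W hW A g hA0 hA1 hA hg
          (fun h => ih (r - 2) (by omega) (A.card + 2) (by omega) (by omega)) x y hx hy
        rcases Nat.lt_or_ge k (A.card + 2) with hlt | hge
        · have e : (k : ℝ) = A.card + 1 := by
            have : k = A.card + 1 := by omega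
            exact_mod_cast this
          have e' : (k : ℝ) - A.card - 1 = 0 := by rw [e]; ring
          rw [e'] at h3
          have h5 : ((hit F A g s(x, y)).card : ℝ) = 0 :=
            le_antisymm (by simpa using h3) (Nat.cast_nonneg _)
          rw [h5, mul_zero]
          exact mul_nonneg hD0n (hW _)
        · have h4 := h2 A.card ha2 hma
          rw [hD2 hge]
          set D2 : ℝ := ((Fintype.card V - (A.card + 2)).descFactorial (k - (A.card + 2)) : ℝ)
          have hD2n : 0 ≤ D2 := Nat.cast_nonneg _
          calc (k : ℝ) * ((hit F A g s(x, y)).card : ℝ)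
              ≤ k * (2 * ((k : ℝ) - A.card - 1) * (D2 * W (A.card + 2))) :=
                mul_le_mul_of_nonneg_left h3 (Nat.cast_nonneg _)
            _ = D2 * ((k : ℝ) * (2 * ((k : ℝ) - A.card - 1)) * W (A.card + 2)) := by ring
            _ ≤ D2 * (((Fintype.card V : ℝ) - A.card) * ((Fintype.card V : ℝ) - A.card - 1)
                * W A.card) := mul_le_mul_of_nonneg_left h4 hD2n
            _ = _ := by ring
  have hk0 : (0 : ℝ) < k := by exact_mod_cast (by omega : 0 < k)
  have h5 : ((cnt F A g).card : ℝ) ≤ ∑ c ∈ C, ((hit F A g c).card : ℝ) := by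
    exact_mod_cast (Finset.card_le_card hsub).trans Finset.card_biUnion_le
  have h6 : (k : ℝ) * ((cnt F A g).card : ℝ) ≤ k * (D0 * W A.card) := by
    calc (k : ℝ) * ((cnt F A g).card : ℝ) ≤ k * ∑ c ∈ C, ((hit F A g c).card : ℝ) :=
          mul_le_mul_of_nonneg_left h5 hk0.le
      _ = ∑ c ∈ C, (k : ℝ) * ((hit F A g c).card : ℝ) := by rw [Finset.mul_sum]
      _ ≤ ∑ c ∈ C, D0 * W A.card := Finset.sum_le_sum hedge
      _ = C.card * (D0 * W A.card) := by rw [Finset.sum_const, nsmul_eq_mul]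
      _ ≤ k * (D0 * W A.card) := by
          apply mul_le_mul_of_nonneg_right _ (mul_nonneg hD0n (hW _))
          exact_mod_cast hFc C hC
  exact le_of_mul_le_mul_left h6 hk0

end Recursion

section Numerics

/-- The numerical requirements on a weight function used in the recursion. -/
def Weight (k n m : ℕ) (W : ℕ → ℝ) : Prop :=
  (∀ a, 0 ≤ W a) ∧ (∀ a, m < a → 1 ≤ W a) ∧
  (∀ a, 2 ≤ a → a ≤ m → (k : ℝ) * W (a + 1) ≤ ((n : ℝ) - a) * W a) ∧
  (∀ a, 2 ≤ a → a ≤ m → (k : ℝ) * (2 * ((k : ℝ) - a - 1)) * W (a + 2) ≤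
      ((n : ℝ) - a) * ((n : ℝ) - a - 1) * W a)

lemma weight_two (k n : ℕ) (hk : 5 ≤ k) (hn : 3 * k ≤ n + 3) :
    Weight k n 2 (fun a => if a = 2 then 1 / 2 else 1) := by
  have hk' : (5 : ℝ) ≤ k := by exact_mod_cast hk
  have hn' : 3 * (k : ℝ) ≤ n + 3 := by exact_mod_cast hn
  refine ⟨?_, ?_, ?_, ?_⟩
  · intro a; dsimp only; split_ifs <;> norm_num
  · intro a ha; dsimp only; rw [if_neg (by omega)]
  · intro a h1 h2
    obtain rfl : a = 2 := by omega
    norm_num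
    linarith
  · intro a h1 h2
    obtain rfl : a = 2 := by omega
    norm_num
    nlinarith [mul_nonneg (sub_nonneg.2 hk') (sub_nonneg.2 hk')]

lemma weight_two_strict (k n : ℕ) (hk : 5 ≤ k) (hn : 3 * k ≤ n + 2) :
    Weight k n 2 (fun a => if a = 2 then 5 / 11 else 1) := by
  have hk' : (5 : ℝ) ≤ k := by exact_mod_cast hk
  have hn' : 3 * (k : ℝ) ≤ n + 2 := by exact_mod_cast hn
  refine ⟨?_, ?_, ?_, ?_⟩
  · intro a; dsimp only; split_ifs <;> norm_num
  · intro a ha; dsimp only; rw [if_neg (by omega)]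
  · intro a h1 h2
    obtain rfl : a = 2 := by omega
    norm_num
    linarith
  · intro a h1 h2
    obtain rfl : a = 2 := by omega
    norm_num
    nlinarith [mul_nonneg (sub_nonneg.2 hk') (sub_nonneg.2 hk')]

lemma weight_five_three (n : ℕ) (hn : 12 ≤ n) :
    Weight 5 n 3 (fun a => if a = 2 then 5 / 18 else if a = 3 then 5 / 9 else 1) := by
  have hn' : (12 : ℝ) ≤ n := by exact_mod_cast hn
  refine ⟨?_, ?_, ?_, ?_⟩
  · intro a; dsimp only; split_ifs <;> norm_num
  · intro a ha; dsimp only; rw [if_neg (by omega), if_neg (by omega)]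
  · intro a h1 h2
    obtain rfl | rfl : a = 2 ∨ a = 3 := by omega
    all_goals norm_num
    all_goals linarith
  · intro a h1 h2
    obtain rfl | rfl : a = 2 ∨ a = 3 := by omega
    all_goals norm_num
    all_goals nlinarith

lemma weight_five_four (n : ℕ) (hn : 12 ≤ n) :
    Weight 5 n 4 (fun a => if a = 2 then 25 / 144 else if a = 3 then 25 / 72 else
      if a = 4 then 5 / 8 else 1) := by
  have hn' : (12 : ℝ) ≤ n := by exact_mod_cast hn
  refine ⟨?_, ?_, ?_, ?_⟩
  · intro a; dsimp only; split_ifs <;> norm_num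
  · intro a ha; dsimp only; rw [if_neg (by omega), if_neg (by omega), if_neg (by omega)]
  · intro a h1 h2
    obtain rfl | rfl | rfl : a = 2 ∨ a = 3 ∨ a = 4 := by omega
    all_goals norm_num
    all_goals linarith
  · intro a h1 h2
    obtain rfl | rfl | rfl : a = 2 ∨ a = 3 ∨ a = 4 := by omega
    all_goals norm_num
    all_goals nlinarith

lemma weight_six (k n m : ℕ) (hk : 6 ≤ k) (hn : 3 * k ≤ n + 3) (hm : m + 2 ≤ k) :
    Weight k n m (fun a => (6 / 11) ^ (m + 1 - a)) := by
  have hk' : (6 : ℝ) ≤ k := by exact_mod_cast hk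
  have hn' : 3 * (k : ℝ) ≤ n + 3 := by exact_mod_cast hn
  refine ⟨?_, ?_, ?_, ?_⟩
  · intro a; positivity
  · intro a ha
    dsimp only
    rw [show m + 1 - a = 0 by omega, pow_zero]
  · intro a h1 h2
    dsimp only
    obtain ⟨q, hq⟩ : ∃ q, m = a + q := ⟨m - a, by omega⟩
    rw [show m + 1 - (a + 1) = q by omega, show m + 1 - a = q + 1 by omega, pow_succ]
    have ha : (a : ℝ) + 2 ≤ k := by exact_mod_cast (by omega : a + 2 ≤ k)
    have hp : (0 : ℝ) < (6 / 11) ^ q := by positivity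
    have : (k : ℝ) ≤ ((n : ℝ) - a) * (6 / 11) := by linarith
    nlinarith
  · intro a h1 h2
    dsimp only
    have ha2 : (2 : ℝ) ≤ a := by exact_mod_cast h1
    have ha : (a : ℝ) + 2 ≤ k := by exact_mod_cast (by omega : a + 2 ≤ k)
    have hw : (36 / 121 : ℝ) * (6 / 11) ^ (m + 1 - (a + 2)) ≤ (6 / 11) ^ (m + 1 - a) := by
      rcases Nat.lt_or_ge a m with h | h
      · rw [show m + 1 - a = (m + 1 - (a + 2)) + 2 by omega, pow_add]
        apply le_of_eq
        ring
      · rw [show m + 1 - a = 1 by omega, show m + 1 - (a + 2) = 0 by omega]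
        norm_num
    have hp : (0 : ℝ) < (6 / 11) ^ (m + 1 - (a + 2)) := by positivity
    have hN : (0 : ℝ) ≤ ((n : ℝ) - a) * ((n : ℝ) - a - 1) :=
      mul_nonneg (by linarith) (by linarith)
    have hmain : (k : ℝ) * (2 * ((k : ℝ) - a - 1)) ≤
        ((n : ℝ) - a) * ((n : ℝ) - a - 1) * (36 / 121) := by
      obtain ⟨r, hr⟩ : ∃ r : ℝ, r = k - a - 1 := ⟨_, rfl⟩
      obtain ⟨s, hs⟩ : ∃ s : ℝ, s = a - 2 := ⟨_, rfl⟩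
      have hs0 : 0 ≤ s := by linarith
      have hr0 : 1 ≤ r := by linarith
      have hke : (k : ℝ) = r + 3 + s := by linarith
      have hae : (a : ℝ) = s + 2 := by linarith
      have hNl : 2 * (k : ℝ) - 2 + r ≤ n - a := by linarith
      have hsq : (2 * (k : ℝ) - 2 + r) * (2 * (k : ℝ) - 3 + r) ≤
          ((n : ℝ) - a) * ((n : ℝ) - a - 1) :=
        mul_le_mul hNl (by linarith) (by linarith) (by linarith)
      have hpoly : (k : ℝ) * (2 * r) ≤
          (2 * (k : ℝ) - 2 + r) * (2 * (k : ℝ) - 3 + r) * (36 / 121) := by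
        rw [hke]
        nlinarith [mul_nonneg hs0 hs0, mul_nonneg hs0 (by linarith : (0 : ℝ) ≤ r), sq_nonneg r]
      rw [← hr]
      linarith
    calc (k : ℝ) * (2 * ((k : ℝ) - a - 1)) * (6 / 11) ^ (m + 1 - (a + 2))
        ≤ ((n : ℝ) - a) * ((n : ℝ) - a - 1) * (36 / 121) * (6 / 11) ^ (m + 1 - (a + 2)) :=
          mul_le_mul_of_nonneg_right hmain hp.le
      _ = ((n : ℝ) - a) * ((n : ℝ) - a - 1) * ((36 / 121) * (6 / 11) ^ (m + 1 - (a + 2))) := by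
          ring
      _ ≤ _ := mul_le_mul_of_nonneg_left hw hN

lemma pow_aux1 (q : ℕ) : ((q : ℝ) + 3) * (6 / 11) ^ (q + 2) < 1 := by
  induction q with
  | zero => norm_num
  | succ q ih =>
    have hp : (0 : ℝ) < (6 / 11) ^ (q + 2) := by positivity
    rw [show q + 1 + 2 = (q + 2) + 1 by ring, pow_succ]
    push_cast
    have : (0 : ℝ) ≤ q := Nat.cast_nonneg q
    nlinarith

lemma pow_aux2 (q : ℕ) : ((q : ℝ) + 6) * (6 / 11) ^ (q + 3) < 1 := by
  induction q with
  | zero => norm_num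
  | succ q ih =>
    have hp : (0 : ℝ) < (6 / 11) ^ (q + 3) := by positivity
    rw [show q + 1 + 3 = (q + 3) + 1 by ring, pow_succ]
    push_cast
    have : (0 : ℝ) ≤ q := Nat.cast_nonneg q
    nlinarith

lemma exists_weight (k n t : ℕ) (hk : 5 ≤ k) (hn : 3 * k ≤ n + 3) (ht : 2 ≤ t) (htk : t ≤ k) :
    ∃ m W, m ≤ t ∧ m < k ∧ Weight k n m W ∧ (t : ℝ) * W 2 ≤ 1 ∧
      (3 * k ≤ n + 2 → (t : ℝ) * W 2 < 1) := by
  have strict : ∀ (m : ℕ) (W : ℕ → ℝ), m ≤ t → m < k → Weight k n m W → (t : ℝ) * W 2 < 1 →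
      ∃ m W, m ≤ t ∧ m < k ∧ Weight k n m W ∧ (t : ℝ) * W 2 ≤ 1 ∧
      (3 * k ≤ n + 2 → (t : ℝ) * W 2 < 1) :=
    fun m W h1 h2 h3 h4 => ⟨m, W, h1, h2, h3, h4.le, fun _ => h4⟩
  rcases Nat.lt_or_ge 2 t with h2 | h2
  · rcases Nat.lt_or_ge 5 k with h5 | h5
    · refine strict (min t (k - 2)) _ (min_le_left _ _) (by omega)
        (weight_six k n _ h5 hn (by omega)) ?_
      rcases Nat.le_total t (k - 2) with h | h
      · rw [min_eq_left h]
        obtain ⟨q, rfl⟩ : ∃ q, t = q + 3 := ⟨t - 3, by omega⟩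
        rw [show q + 3 + 1 - 2 = q + 2 by omega]
        have := pow_aux1 q
        push_cast
        exact this
      · rw [min_eq_right h]
        obtain ⟨q, rfl⟩ : ∃ q, k = q + 6 := ⟨k - 6, by omega⟩
        rw [show q + 6 - 2 + 1 - 2 = q + 3 by omega]
        have := pow_aux2 q
        have h3 : (t : ℝ) ≤ q + 6 := by exact_mod_cast htk
        have hp : (0 : ℝ) < (6 / 11) ^ (q + 3) := by positivity
        nlinarith
    · obtain rfl : k = 5 := by omega
      rcases Nat.lt_or_ge 3 t with h3 | h3
      · refine strict 4 _ h3 (by omega) (weight_five_four n (by omega)) ?_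
        have : (t : ℝ) ≤ 5 := by exact_mod_cast htk
        norm_num
        linarith
      · refine strict 3 _ h2 (by omega) (weight_five_three n (by omega)) ?_
        have : (t : ℝ) ≤ 3 := by exact_mod_cast h3
        norm_num
        linarith
  · obtain rfl : t = 2 := by omega
    by_cases h : 3 * k ≤ n + 2
    · refine strict 2 _ le_rfl (by omega) (weight_two_strict k n hk h) ?_
      norm_num
    · refine ⟨2, _, le_rfl, by omega, weight_two k n hk hn, by norm_num, fun h' => absurd h' h⟩

end Numerics

section Final

open Classical

variable {n k : ℕ} [NeZero k]

/-- The map with `0 ↦ u` and everything else to `v`. -/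
noncomputable def startMap (k : ℕ) (u v : Fin n) : ZMod k → Fin n := fun i => if i = 0 then u else v

lemma one_ne_zero_zmod (hk : 5 ≤ k) : (1 : ZMod k) ≠ 0 := by
  intro h
  have h1 : ((1 : ℕ) : ZMod k) = 0 := by simpa using h
  rw [ZMod.natCast_eq_zero_iff] at h1
  have := Nat.le_of_dvd (by norm_num) h1
  omega

lemma mem_exts_start (hk : 5 ≤ k) (u v : Fin n) (φ : ZMod k → Fin n) :
    φ ∈ exts {0, 1} (startMap k u v) ↔ Function.Injective φ ∧ φ 0 = u ∧ φ 1 = v := by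
  simp [mem_exts, startMap, one_ne_zero_zmod hk]

lemma start_card (hk : 5 ≤ k) : ({0, 1} : Finset (ZMod k)).card = 2 :=
  Finset.card_pair (one_ne_zero_zmod hk).symm

lemma start_good : Good ({0, 1} : Finset (ZMod k)) := by
  intro i hi
  simp only [Finset.mem_insert, Finset.mem_singleton] at hi
  rcases hi with rfl | rfl
  · left; simp
  · right; simp

lemma start_injOn (hk : 5 ≤ k) (u v : Fin n) (huv : u ≠ v) :
    Set.InjOn (startMap k u v) ({0, 1} : Finset (ZMod k)) := by
  have := one_ne_zero_zmod hk
  intro a ha b hb hab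
  simp only [Finset.coe_insert, Finset.coe_singleton, Set.mem_insert_iff,
    Set.mem_singleton_iff] at ha hb
  rcases ha with rfl | rfl <;> rcases hb with rfl | rfl
  · rfl
  · simp [startMap, this] at hab; exact absurd hab huv
  · simp [startMap, this] at hab; exact absurd hab.symm huv
  · rfl

lemma exts_start_card (hk : 5 ≤ k) (u v : Fin n) (huv : u ≠ v) :
    (exts ({0, 1} : Finset (ZMod k)) (startMap k u v)).card = (n - 2).descFactorial (k - 2) := by
  rw [card_exts (k - 2) _ _ (start_injOn hk u v huv) (by rw [start_card hk]; omega),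
    start_card hk, Fintype.card_fin]

lemma famAt_le_cnt (hk : 5 ≤ k) (F : Set (Finset (Sym2 (Fin n)))) (hF : F ⊆ cycleFamily n k)
    (u v : Fin n) : (famAt F s(u, v)).ncard ≤
      (cnt F ({0, 1} : Finset (ZMod k)) (startMap k u v)).card := by
  have hsub : famAt F s(u, v) ⊆
      cyc '' (cnt F ({0, 1} : Finset (ZMod k)) (startMap k u v) : Set (ZMod k → Fin n)) := by
    rintro E ⟨hE, he⟩
    obtain ⟨φ, hφ, rfl⟩ := exists_of_mem_cycleFamily (hF hE)
    obtain ⟨ψ, hψ, h1, h2, h3⟩ := exists_rotation φ hφ u v he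
    refine ⟨ψ, ?_, h1⟩
    rw [Finset.mem_coe, mem_cnt, mem_exts_start hk]
    exact ⟨⟨hψ, h2, h3⟩, h1 ▸ hE⟩
  calc _ ≤ _ := Set.ncard_le_ncard hsub (Set.toFinite _)
    _ ≤ _ := Set.ncard_image_le (Set.toFinite _)
    _ = _ := Set.ncard_coe_finset _

lemma famAt_diag (hk : 5 ≤ k) (F : Set (Finset (Sym2 (Fin n)))) (hF : F ⊆ cycleFamily n k)
    (u : Fin n) : famAt F s(u, u) = ∅ := by
  rw [Set.eq_empty_iff_forall_notMem]
  rintro E ⟨hE, he⟩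
  obtain ⟨φ, hφ, rfl⟩ := exists_of_mem_cycleFamily (hF hE)
  obtain ⟨ψ, hψ, h1, h2, h3⟩ := exists_rotation φ hφ u u he
  exact one_ne_zero_zmod hk (hψ (h3.trans h2.symm))

lemma star_le (hk : 5 ≤ k) (e : Sym2 (Fin n)) :
    (famAt (cycleFamily n k) e).ncard ≤ (n - 2).descFactorial (k - 2) := by
  induction e using Sym2.ind with
  | _ u v =>
  by_cases huv : u = v
  · subst huv
    rw [famAt_diag hk _ subset_rfl, Set.ncard_empty]
    exact Nat.zero_le _
  · rw [← exts_start_card hk u v huv]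
    exact (famAt_le_cnt hk _ subset_rfl u v).trans (Finset.card_le_card (Finset.filter_subset _ _))

lemma star_ge (hk : 5 ≤ k) (u v : Fin n) (huv : u ≠ v) :
    (n - 2).descFactorial (k - 2) ≤ (famAt (cycleFamily n k) s(u, v)).ncard := by
  rw [← exts_start_card hk u v huv, ← Set.ncard_coe_finset]
  have hinj : Set.InjOn cyc
      (exts ({0, 1} : Finset (ZMod k)) (startMap k u v) : Set (ZMod k → Fin n)) := by
    intro φ hφ ψ hψ h
    rw [Finset.mem_coe, mem_exts_start hk] at hφ hψ
    exact cyc_inj (by omega) φ ψ hφ.1 hψ.1 (hφ.2.1.trans hψ.2.1.symm)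
      (hφ.2.2.trans hψ.2.2.symm) h
  rw [← Set.ncard_image_of_injOn hinj]
  apply Set.ncard_le_ncard _ (Set.toFinite _)
  rintro E ⟨φ, hφ, rfl⟩
  rw [Finset.mem_coe, mem_exts_start hk] at hφ
  refine ⟨cyc_mem_cycleFamily (by omega) φ hφ.1, ?_⟩
  rw [mem_cyc]
  exact ⟨0, by rw [zero_add, hφ.2.1, hφ.2.2]⟩

lemma cyc_card_le {V : Type*} [DecidableEq V] (φ : ZMod k → V) : (cyc φ).card ≤ k := by
  refine Finset.card_image_le.trans ?_
  rw [Finset.card_univ, ZMod.card]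

lemma cover_bound (hk : 5 ≤ k) (hn : k ≤ n) (F : Set (Finset (Sym2 (Fin n))))
    (hF : F ⊆ cycleFamily n k) (hFi : IsIntersectingFamily F) (m : ℕ) (hm : m < k)
    (hcov : ∀ T : Finset (Sym2 (Fin n)), T.card < m → ∃ C ∈ F, ∀ e ∈ C, e ∉ T)
    (W : ℕ → ℝ) (hW : Weight k n m W) (T : Finset (Sym2 (Fin n)))
    (hT : ∀ C ∈ F, ∃ e ∈ C, e ∈ T) :
    (F.ncard : ℝ) ≤ ((n - 2).descFactorial (k - 2) : ℝ) * ((T.card : ℝ) * W 2) := by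
  obtain ⟨hW0, hW1, hWa, hWb⟩ := hW
  have hFc : ∀ C ∈ F, C.card ≤ k := by
    intro C hC
    obtain ⟨φ, _, rfl⟩ := exists_of_mem_cycleFamily (hF hC)
    exact cyc_card_le φ
  have hB := bnd_all (V := Fin n) (k := k) (by omega) (by simpa using hn) F hFi hFc m hm hcov W
    hW0 hW1 (by simpa using hWa) (by simpa using hWb) (k - 2) 2 (by omega) le_rfl
  have he : ∀ e : Sym2 (Fin n), ((famAt F e).ncard : ℝ) ≤
      ((n - 2).descFactorial (k - 2) : ℝ) * W 2 := by
    intro e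
    induction e using Sym2.ind with
    | _ u v =>
    by_cases huv : u = v
    · subst huv
      rw [famAt_diag hk _ hF, Set.ncard_empty, Nat.cast_zero]
      exact mul_nonneg (Nat.cast_nonneg _) (hW0 _)
    · have h1 := hB {0, 1} (startMap k u v) (start_card hk) start_good (start_injOn hk u v huv)
      rw [Fintype.card_fin] at h1
      refine le_trans ?_ h1
      exact_mod_cast famAt_le_cnt hk F hF u v
  have hsub : (Set.toFinite F).toFinset ⊆ T.biUnion (fun e => (Set.toFinite (famAt F e)).toFinset) := by
    intro C hC
    rw [Set.Finite.mem_toFinset] at hC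
    obtain ⟨e, he, heT⟩ := hT C hC
    rw [Finset.mem_biUnion]
    refine ⟨e, heT, ?_⟩
    rw [Set.Finite.mem_toFinset]
    exact ⟨hC, he⟩
  have h2 := (Finset.card_le_card hsub).trans Finset.card_biUnion_le
  simp only [← Set.ncard_eq_toFinset_card] at h2
  calc (F.ncard : ℝ) ≤ ∑ e ∈ T, ((famAt F e).ncard : ℝ) := by exact_mod_cast h2
    _ ≤ ∑ e ∈ T, ((n - 2).descFactorial (k - 2) : ℝ) * W 2 := Finset.sum_le_sum fun e _ => he e
    _ = _ := by rw [Finset.sum_const, nsmul_eq_mul]; ring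

lemma dichotomy_s7 (hk : 5 ≤ k) (hn : 3 * k ≤ n + 3) (F : Set (Finset (Sym2 (Fin n))))
    (hF : F ⊆ cycleFamily n k) (hFi : IsIntersectingFamily F) :
    (∃ e, ∀ C ∈ F, e ∈ C) ∨ (F.ncard ≤ (n - 2).descFactorial (k - 2) ∧
      (3 * k ≤ n + 2 → F.ncard < (n - 2).descFactorial (k - 2))) := by
  rcases F.eq_empty_or_nonempty with rfl | ⟨C0, hC0⟩
  · left
    exact ⟨s(⟨0, by omega⟩, ⟨0, by omega⟩), fun C hC => absurd hC (Set.notMem_empty C)⟩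
  have hex : ∃ t, ∃ T : Finset (Sym2 (Fin n)), T.card = t ∧ ∀ C ∈ F, ∃ e ∈ C, e ∈ T :=
    ⟨C0.card, C0, rfl, fun C hC => hFi C hC C0 hC0⟩
  obtain ⟨T, hTc, hT⟩ := Nat.find_spec hex
  have hmin : ∀ T' : Finset (Sym2 (Fin n)), T'.card < Nat.find hex → ∃ C ∈ F, ∀ e ∈ C, e ∉ T' := by
    intro T' hT'
    have := Nat.find_min hex hT'
    push Not at this
    exact this T' rfl
  have htk : Nat.find hex ≤ k := by
    refine (Nat.find_min' hex ⟨C0, rfl, fun C hC => hFi C hC C0 hC0⟩).trans ?_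
    obtain ⟨φ, _, rfl⟩ := exists_of_mem_cycleFamily (hF hC0)
    exact cyc_card_le φ
  generalize Nat.find hex = t at *
  rcases Nat.lt_or_ge t 2 with h | h
  · left
    obtain ⟨e0, he0, he0T⟩ := hT C0 hC0
    refine ⟨e0, fun C hC => ?_⟩
    obtain ⟨e, he, heT⟩ := hT C hC
    have := Finset.card_le_one.1 (by omega : T.card ≤ 1) e heT e0 he0T
    exact this ▸ he
  · right
    obtain ⟨m, W, hmt, hmk, hW, h1, h2⟩ := exists_weight k n t hk hn h htk
    have hb := cover_bound hk (by omega) F hF hFi m hmk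
      (fun T' hT' => hmin T' (by omega)) W hW T hT
    rw [hTc] at hb
    have hpos : (0 : ℝ) < ((n - 2).descFactorial (k - 2) : ℝ) := by
      have : 0 < (n - 2).descFactorial (k - 2) := Nat.pos_of_ne_zero (by
        rw [Ne, Nat.descFactorial_eq_zero_iff_lt]; omega)
      exact_mod_cast this
    constructor
    · have : (F.ncard : ℝ) ≤ ((n - 2).descFactorial (k - 2) : ℝ) :=
        hb.trans (mul_le_of_le_one_right hpos.le h1)
      exact_mod_cast this
    · intro h3
      have : (F.ncard : ℝ) < ((n - 2).descFactorial (k - 2) : ℝ) :=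
        hb.trans_lt (mul_lt_of_lt_one_right hpos (h2 h3))
      exact_mod_cast this

lemma ekr_aux (hk : 5 ≤ k) (hn : 3 * k ≤ n + 3) :
    IsEKRFamily (⊤ : SimpleGraph (Fin n)).edgeSet (cycleFamily n k) := by
  intro x hx F hF hFi
  induction x using Sym2.ind with
  | _ u v =>
  have huv : u ≠ v := by simpa using hx
  refine le_trans ?_ (star_ge hk u v huv)
  rcases dichotomy_s7 hk hn F hF hFi with ⟨e, he⟩ | ⟨h, _⟩
  · have hsub : F ⊆ famAt (cycleFamily n k) e := fun C hC => ⟨hF hC, he C hC⟩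
    exact (Set.ncard_le_ncard hsub (Set.toFinite _)).trans (star_le hk e)
  · exact h

end Final

/-- Let `k ≥ 5`. For every `n ≥ 3k - 3` the family of all `k`-cycles of `K_n` is an EKR family,
and for every `n ≥ 3k - 2` it is a strong EKR family. -/
theorem kCycles_EKR (k n : ℕ) (hk : 5 ≤ k) :
    (3 * k - 3 ≤ n → IsEKRFamily (⊤ : SimpleGraph (Fin n)).edgeSet (cycleFamily n k)) ∧
    (3 * k - 2 ≤ n → IsStrongEKRFamily (⊤ : SimpleGraph (Fin n)).edgeSet (cycleFamily n k)) := by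
  haveI : NeZero k := ⟨by omega⟩
  refine ⟨fun hn => ekr_aux hk (by omega), fun hn => ⟨ekr_aux hk (by omega), ?_⟩⟩
  intro F hF hFi hmax
  have huv : (⟨0, by omega⟩ : Fin n) ≠ ⟨1, by omega⟩ := by simp
  have hS : (n - 2).descFactorial (k - 2) ≤ F.ncard :=
    (star_ge hk _ _ huv).trans (hmax _ (fun C hC => hC.1) (fun A hA B hB => ⟨_, hA.2, hB.2⟩))
  have hpos : 0 < (n - 2).descFactorial (k - 2) := Nat.pos_of_ne_zero (by
    rw [Ne, Nat.descFactorial_eq_zero_iff_lt]; omega)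
  rcases dichotomy_s7 hk (by omega) F hF hFi with ⟨e, he⟩ | ⟨_, h⟩
  · refine ⟨e, ?_, ?_⟩
    · obtain ⟨C, hC⟩ := Set.nonempty_of_ncard_ne_zero (by omega : F.ncard ≠ 0)
      have hmem : C ∈ famAt F e := ⟨hC, he C hC⟩
      induction e using Sym2.ind with
      | _ u v =>
      rw [SimpleGraph.mem_edgeSet, SimpleGraph.top_adj]
      rintro rfl
      rw [famAt_diag hk F hF] at hmem
      exact hmem
    · exact Set.eq_of_subset_of_ncard_le (fun C hC => ⟨hF hC, he C hC⟩)
        ((star_le hk e).trans hS) (Set.toFinite _)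
  · exact absurd (h (by omega)) (by omega)
end
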